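/- arXiv:2402.04138 — 12 statements merged into one kernel-verified Lean document; each statement's English description precedes it below -/
import Mathlib

section
/- Fix k ∈ ℝ, k ≠ 0, and a dataset (𝔱,T) with n ≥ 3. A pair (a,b) ∈ ℝ² minimizes the map (a',b') ↦ max_{1≤i≤n} |a'·exp(k·t_i)+b' − T_i| if and only if there exist indices 1 ≤ i < j < m ≤ n and δ ∈ {−1,1} such that (a·exp(k·t_i)+b) − T_i = T_j − (a·exp(k·t_j)+b) = (a·exp(k·t_m)+b) − T_m = δ·max_{1≤l≤n}|a·exp(k·t_l)+b − T_l|. -/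
open Real

/-- A perturbation direction with the sign of the residual at every extremal index strictly
decreases the max-norm of the residual. -/
theorem exists_iSup_abs_sub_mul_lt {ι : Type*} [Finite ι] [Nonempty ι] {r l : ι → ℝ} {M : ℝ}
    (hM : 0 < M) (hr : ∀ i, |r i| ≤ M) (hpos : ∀ i, r i = M → 0 < l i)
    (hneg : ∀ i, r i = -M → l i < 0) :
    ∃ ε : ℝ, (⨆ i, |r i - ε * l i|) < M := by
  have hev : ∀ᶠ ε : ℝ in nhdsWithin 0 (Set.Ioi 0), ∀ i, |r i - ε * l i| < M := by
    rw [Filter.eventually_all]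
    intro i
    have hlim (c : ℝ) : Filter.Tendsto (fun ε : ℝ => c - ε * l i)
        (nhdsWithin 0 (Set.Ioi 0)) (nhds c) := by
      have : Continuous (fun ε : ℝ => c - ε * l i) := by fun_prop
      simpa using (this.tendsto 0).mono_left nhdsWithin_le_nhds
    have hi := abs_le.1 (hr i)
    rcases eq_or_ne (r i) M with h | h
    · filter_upwards [(hlim (r i)).eventually_const_lt (show -M < r i by linarith),
        self_mem_nhdsWithin] with ε h1 h2
      have := mul_pos (Set.mem_Ioi.1 h2) (hpos i h)
      exact abs_lt.2 ⟨h1, by linarith⟩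
    rcases eq_or_ne (r i) (-M) with h' | h'
    · filter_upwards [(hlim (r i)).eventually_lt_const (show r i < M by linarith),
        self_mem_nhdsWithin] with ε h1 h2
      have := mul_neg_of_pos_of_neg (Set.mem_Ioi.1 h2) (hneg i h')
      exact abs_lt.2 ⟨by linarith, h1⟩
    · filter_upwards [(hlim (r i)).eventually_lt_const (lt_of_le_of_ne hi.2 h),
        (hlim (r i)).eventually_const_lt (lt_of_le_of_ne hi.1 h'.symm)] with ε h1 h2
      exact abs_lt.2 ⟨h2, h1⟩
  obtain ⟨ε, hε⟩ := hev.exists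
  obtain ⟨i, hi⟩ := exists_eq_ciSup_of_finite (f := fun i => |r i - ε * l i|)
  exact ⟨ε, hi ▸ hε i⟩

/-- Two finite index sets, one before the other, are strictly separated by a real number. -/
theorem exists_separating_of_strictMono {ι : Type*} [Fintype ι] [Preorder ι] {x : ι → ℝ}
    (hx : StrictMono x) {P N : ι → Prop} (h : ∀ i j, P i → N j → i < j) :
    ∃ c : ℝ, (∀ i, P i → x i < c) ∧ ∀ j, N j → c < x j := by
  classical
  obtain ⟨c, h1, h2⟩ := Order.exists_between_finsets
    ((Finset.univ.filter P).image x) ((Finset.univ.filter N).image x) (by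
      simp only [Finset.mem_image, Finset.mem_filter, Finset.mem_univ, true_and]
      rintro _ ⟨i, hi, rfl⟩ _ ⟨j, hj, rfl⟩
      exact hx (h i j hi hj))
  exact ⟨c, fun i hi => h1 _ (Finset.mem_image_of_mem x (by simpa using hi)),
    fun j hj => h2 _ (Finset.mem_image_of_mem x (by simpa using hj))⟩

/-- Chebyshev equioscillation for discrete affine approximation, in terms of residuals. -/
theorem forall_iSup_abs_le_iff_equioscillates {n : ℕ} (hn : 3 ≤ n) {x : Fin n → ℝ}
    (hx : StrictMono x) (r : Fin n → ℝ) :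
    (∀ p q : ℝ, (⨆ i, |r i|) ≤ ⨆ i, |r i + (p * x i + q)|) ↔
      ∃ i j m : Fin n, i < j ∧ j < m ∧ ∃ δ : ℝ, (δ = 1 ∨ δ = -1) ∧
        r i = δ * (⨆ l, |r l|) ∧ -r j = δ * (⨆ l, |r l|) ∧ r m = δ * (⨆ l, |r l|) := by
  have : Nonempty (Fin n) := ⟨⟨0, by omega⟩⟩
  set M := ⨆ l, |r l|
  have hle (i : Fin n) : |r i| ≤ M :=
    le_ciSup (f := fun l => |r l|) (Set.finite_range _).bddAbove i
  constructor
  · intro hmin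
    by_contra hno
    have hM : 0 < M := by
      refine lt_of_not_ge fun hM0 => hno ?_
      have hM : M = 0 := le_antisymm hM0 ((abs_nonneg _).trans (hle ⟨0, by omega⟩))
      have hr (i : Fin n) : r i = 0 := abs_nonpos_iff.1 (hM ▸ hle i)
      exact ⟨⟨0, by omega⟩, ⟨1, by omega⟩, ⟨2, by omega⟩, by simp, by simp, 1, Or.inl rfl,
        by simp [hr, hM]⟩
    have hne {i j : Fin n} (hi : r i = M) (hj : r j = -M) : i ≠ j := by
      rintro rfl
      linarith
    have hsep : (∀ i j, r i = M → r j = -M → i < j) ∨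
        (∀ j i, r j = -M → r i = M → j < i) := by
      by_contra! hcon
      obtain ⟨⟨i, j, hi, hj, hij⟩, j', i', hj', hi', hij'⟩ := hcon
      have h1 : j < i := lt_of_le_of_ne hij (hne hi hj).symm
      have h2 : i' < j' := lt_of_le_of_ne hij' (hne hi' hj')
      rcases lt_or_gt_of_ne (hne hi' hj) with h3 | h3
      · exact hno ⟨i', j, i, h3, h1, 1, Or.inl rfl, by linarith, by linarith, by linarith⟩
      · exact hno ⟨j, i', j', h3, h2, -1, Or.inr rfl, by linarith, by linarith, by linarith⟩
    have hdir : ∃ u v : ℝ, (∀ i, r i = M → 0 < u * x i + v) ∧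
        ∀ i, r i = -M → u * x i + v < 0 := by
      rcases hsep with h | h
      · obtain ⟨c, h1, h2⟩ := exists_separating_of_strictMono hx h
        exact ⟨-1, c, fun i hi => by linarith [h1 i hi], fun i hi => by linarith [h2 i hi]⟩
      · obtain ⟨c, h1, h2⟩ := exists_separating_of_strictMono hx h
        exact ⟨1, -c, fun i hi => by linarith [h2 i hi], fun i hi => by linarith [h1 i hi]⟩
    obtain ⟨u, v, hpos, hneg⟩ := hdir
    obtain ⟨ε, hε⟩ := exists_iSup_abs_sub_mul_lt hM hle hpos hneg
    refine absurd (hmin (-ε * u) (-ε * v)) (not_le.2 ?_)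
    have hsub (i : Fin n) : r i + (-ε * u * x i + -ε * v) = r i - ε * (u * x i + v) := by ring
    simpa only [hsub] using hε
  · rintro ⟨i, j, m, hij, hjm, δ, hδ, hi, hj, hm⟩ p q
    by_contra! hlt
    have hbound (l : Fin n) : |r l + (p * x l + q)| < M :=
      (le_ciSup (f := fun l => |r l + (p * x l + q)|) (Set.finite_range _).bddAbove l).trans_lt hlt
    have bi := abs_lt.1 (hbound i)
    have bj := abs_lt.1 (hbound j)
    have bm := abs_lt.1 (hbound m)
    have xij := hx hij
    have xjm := hx hjm
    rcases hδ with rfl | rfl <;> rcases le_total 0 p with hp | hp <;> nlinarith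

/-- The equioscillation criterion for `a * x + b` with strictly increasing nodes. -/
theorem forall_iSup_abs_affine_le_iff {n : ℕ} (hn : 3 ≤ n) {x : Fin n → ℝ}
    (hx : StrictMono x) (T : Fin n → ℝ) (a b : ℝ) :
    (∀ a' b' : ℝ, (⨆ i, |a * x i + b - T i|) ≤ ⨆ i, |a' * x i + b' - T i|) ↔
      ∃ i j m : Fin n, i < j ∧ j < m ∧ ∃ δ : ℝ, (δ = 1 ∨ δ = -1) ∧
        (a * x i + b) - T i = δ * (⨆ l, |a * x l + b - T l|) ∧
        T j - (a * x j + b) = δ * (⨆ l, |a * x l + b - T l|) ∧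
        (a * x m + b) - T m = δ * (⨆ l, |a * x l + b - T l|) := by
  have key := forall_iSup_abs_le_iff_equioscillates hn hx (fun i => a * x i + b - T i)
  simp only [neg_sub] at key
  rw [← key]
  constructor
  · intro h p q
    convert h (a + p) (b + q) using 4
    ring
  · intro h a' b'
    convert h (a' - a) (b' - b) using 4
    ring

/-- For fixed `k ≠ 0` and a dataset with `n ≥ 3`, a pair `(a,b)` minimizes the
max-norm error if and only if the error equioscillates at three indices. -/
theorem stmt_0 (n : ℕ) (hn : 3 ≤ n) (t T : Fin n → ℝ) (ht : StrictMono t)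
    (k : ℝ) (hk : k ≠ 0) (a b : ℝ) :
    (∀ a' b' : ℝ,
        (⨆ i : Fin n, |a * Real.exp (k * t i) + b - T i|) ≤
          ⨆ i : Fin n, |a' * Real.exp (k * t i) + b' - T i|) ↔
      ∃ i j m : Fin n, i < j ∧ j < m ∧ ∃ δ : ℝ, (δ = 1 ∨ δ = -1) ∧
        (a * Real.exp (k * t i) + b) - T i
          = δ * ⨆ l : Fin n, |a * Real.exp (k * t l) + b - T l| ∧
        T j - (a * Real.exp (k * t j) + b)
          = δ * ⨆ l : Fin n, |a * Real.exp (k * t l) + b - T l| ∧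
        (a * Real.exp (k * t m) + b) - T m
          = δ * ⨆ l : Fin n, |a * Real.exp (k * t l) + b - T l| := by
  rcases lt_or_gt_of_ne hk with hk | hk
  · have hx : StrictMono fun i => -Real.exp (k * t i) := fun i j hij =>
      neg_lt_neg (Real.exp_lt_exp.2 (mul_lt_mul_of_neg_left (ht hij) hk))
    have key := forall_iSup_abs_affine_le_iff hn hx T (-a) b
    simp only [neg_mul_neg] at key
    rw [← key]
    constructor
    · intro h a' b'
      simpa using h (-a') b'
    · intro h a' b'
      simpa using h (-a') b'
  · have hx : StrictMono fun i => Real.exp (k * t i) := fun i j hij =>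
      Real.exp_lt_exp.2 (mul_lt_mul_of_pos_left (ht hij) hk)
    exact forall_iSup_abs_affine_le_iff hn hx T a b
end

section
/- Let (𝔱,T) be a dataset with n = 3, let k ≠ 0 and suppose T_1 ≠ T_3. Then the pair (a_k, b_k) given by a_k = (T_1−T_3)/(exp(k·t_1)−exp(k·t_3)) and b_k = (1/2)·(T_1 − a_k·exp(k·t_1) + T_2 − a_k·exp(k·t_2)) minimizes the map (a,b) ↦ max_{1≤i≤3} |a·exp(k·t_i)+b − T_i| over all (a,b) ∈ ℝ². -/
open Real

/-- An affine fit `a * x + b` at three monotone nodes whose residuals alternate in sign with equal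
modulus has minimal sup-norm error among all affine fits. -/
lemma iSup_abs_residual_le_of_equioscillation {x T : Fin 3 → ℝ}
    (hx : 0 < (x 2 - x 1) * (x 1 - x 0)) {a b : ℝ}
    (h₂ : a * x 2 + b - T 2 = a * x 0 + b - T 0)
    (h₁ : a * x 1 + b - T 1 = -(a * x 0 + b - T 0)) (c d : ℝ) :
    (⨆ i, |a * x i + b - T i|) ≤ ⨆ i, |c * x i + d - T i| := by
  have hle (i : Fin 3) : |c * x i + d - T i| ≤ ⨆ j, |c * x j + d - T j| :=
    le_ciSup (f := fun j => |c * x j + d - T j|) (Set.finite_range _).bddAbove i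
  set M := ⨆ j, |c * x j + d - T j|
  have hr : |a * x 0 + b - T 0| ≤ M := by
    obtain ⟨l0, u0⟩ := abs_le.1 (hle 0)
    obtain ⟨l1, u1⟩ := abs_le.1 (hle 1)
    obtain ⟨l2, u2⟩ := abs_le.1 (hle 2)
    have key : 2 * (x 2 - x 0) * (a * x 0 + b - T 0) = (x 2 - x 1) * (c * x 0 + d - T 0)
        + (x 1 - x 0) * (c * x 2 + d - T 2) - (x 2 - x 0) * (c * x 1 + d - T 1) := by
      linear_combination (x 2 - x 0) * h₁ - (x 1 - x 0) * h₂
    generalize a * x 0 + b - T 0 = r at key ⊢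
    generalize c * x 0 + d - T 0 = e at *
    generalize c * x 1 + d - T 1 = f at *
    generalize c * x 2 + d - T 2 = g at *
    rw [abs_le]
    rcases pos_and_pos_or_neg_and_neg_of_mul_pos hx with ⟨hp, hq⟩ | ⟨hp, hq⟩
    · constructor <;> refine le_of_mul_le_mul_left ?_ (by linarith : 0 < x 2 - x 0) <;> nlinarith
    · constructor <;> refine le_of_mul_le_mul_left ?_ (by linarith : 0 < x 0 - x 2) <;> nlinarith
  refine ciSup_le fun i => ?_
  fin_cases i
  · exact hr
  · simpa only [Fin.mk_one, h₁, abs_neg] using hr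
  · simpa only [Fin.reduceFinMk, h₂] using hr

/-- For a dataset with `n = 3`, `k ≠ 0` and `T 0 ≠ T 2`, the explicit pair
`(a_k, b_k)` minimizes the max-norm error for exponent `k`. -/
theorem stmt_1 (t T : Fin 3 → ℝ) (ht : StrictMono t) (k : ℝ) (hk : k ≠ 0)
    (hT : T 0 ≠ T 2) (ak bk : ℝ)
    (hak : ak = (T 0 - T 2) / (Real.exp (k * t 0) - Real.exp (k * t 2)))
    (hbk : bk = (1 / 2) * (T 0 - ak * Real.exp (k * t 0) + T 1 - ak * Real.exp (k * t 1))) :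
    ∀ a b : ℝ,
      (⨆ i : Fin 3, |ak * Real.exp (k * t i) + bk - T i|) ≤
        ⨆ i : Fin 3, |a * Real.exp (k * t i) + b - T i| := by
  have hx : 0 < (exp (k * t 2) - exp (k * t 1)) * (exp (k * t 1) - exp (k * t 0)) := by
    have h01 : t 0 < t 1 := ht (by decide)
    have h12 : t 1 < t 2 := ht (by decide)
    rcases hk.lt_or_gt with hk | hk
    · exact mul_pos_of_neg_of_neg
        (sub_neg.2 (exp_lt_exp.2 (mul_lt_mul_of_neg_left h12 hk)))
        (sub_neg.2 (exp_lt_exp.2 (mul_lt_mul_of_neg_left h01 hk)))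
    · exact mul_pos
        (sub_pos.2 (exp_lt_exp.2 (mul_lt_mul_of_pos_left h12 hk)))
        (sub_pos.2 (exp_lt_exp.2 (mul_lt_mul_of_pos_left h01 hk)))
  have hne : exp (k * t 0) - exp (k * t 2) ≠ 0 := fun h => by
    rw [← sub_eq_zero.1 h] at hx
    nlinarith [sq_nonneg (exp (k * t 1) - exp (k * t 0))]
  have hslope : ak * (exp (k * t 0) - exp (k * t 2)) = T 0 - T 2 := by
    rw [hak, div_mul_cancel₀ _ hne]
  refine iSup_abs_residual_le_of_equioscillation (x := fun i => exp (k * t i)) hx ?_ ?_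
  · linear_combination -hslope
  · linear_combination 2 * hbk
end

section
/- Let (𝔱,T) be a dataset with n = 4 such that (T_1−T_3)/(t_3−t_1) > (T_2−T_4)/(t_4−t_2) > 0. Then there exists a unique triple (a,k,b) ∈ ℝ³ with a > 0 and k < 0 such that the function f(t) = a·exp(k·t)+b satisfies T_1−f(t_1) = −(T_2−f(t_2)) = T_3−f(t_3) = −(T_4−f(t_4)). -/
open Real

/-- The exponential polynomial whose negative zero is the decay rate of the equioscillating
exponential, after normalizing the second node to `0`. -/
noncomputable def rateFun (A B p q r k : ℝ) : ℝ :=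
  B * (exp (k * -p) - exp (k * q)) - A * (1 - exp (k * r))

theorem hasDerivAt_rateFun (A B p q r k : ℝ) :
    HasDerivAt (rateFun A B p q r)
      (B * (exp (k * -p) * -p - exp (k * q) * q) + A * (exp (k * r) * r)) k := by
  have h : ∀ c : ℝ, HasDerivAt (fun k => exp (k * c)) (exp (k * c) * c) k := fun c => by
    simpa using ((hasDerivAt_id k).mul_const c).exp
  have h' := (((h (-p)).sub (h q)).const_mul B).sub
    (((hasDerivAt_const k (1 : ℝ)).sub (h r)).const_mul A)
  exact h'.congr_deriv (by ring)

theorem continuous_rateFun (A B p q r : ℝ) : Continuous (rateFun A B p q r) := by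
  unfold rateFun
  fun_prop

theorem rateFun_zero (A B p q r : ℝ) : rateFun A B p q r 0 = 0 := by
  simp [rateFun]

/-- The derivative of `rateFun` has at most one zero. -/
theorem deriv_rateFun_zero_unique {A B p q r x y : ℝ} (hA : 0 < A) (hB : 0 < B) (hp : 0 < p)
    (hq : 0 < q) (hr : q < r) (hxy : x < y)
    (hx : B * (exp (x * -p) * -p - exp (x * q) * q) + A * (exp (x * r) * r) = 0)
    (hy : B * (exp (y * -p) * -p - exp (y * q) * q) + A * (exp (y * r) * r) = 0) : False := by
  have key : ∀ z : ℝ, B * (exp (z * -p) * -p - exp (z * q) * q) + A * (exp (z * r) * r) = 0 →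
      A * r * exp (z * (r - q)) - B * p * exp (-(z * (p + q))) = B * q := by
    intro z hz
    have e1 : exp (z * r) = exp (z * (r - q)) * exp (z * q) := by
      rw [← exp_add]; ring_nf
    have e2 : exp (z * -p) = exp (-(z * (p + q))) * exp (z * q) := by
      rw [← exp_add]; ring_nf
    rw [e1, e2] at hz
    have : exp (z * q) * (A * r * exp (z * (r - q)) - B * p * exp (-(z * (p + q))) - B * q) = 0 := by
      linear_combination hz
    rcases mul_eq_zero.mp this with h | h
    · exact absurd h (exp_pos _).ne'
    · linarith
  have kx := key x hx
  have ky := key y hy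
  have i1 : exp (x * (r - q)) < exp (y * (r - q)) :=
    exp_lt_exp.mpr (mul_lt_mul_of_pos_right hxy (by linarith))
  have i2 : exp (-(y * (p + q))) < exp (-(x * (p + q))) :=
    exp_lt_exp.mpr (neg_lt_neg (mul_lt_mul_of_pos_right hxy (by linarith)))
  have j1 := mul_lt_mul_of_pos_left i1 (mul_pos hA (hq.trans hr))
  have j2 := mul_lt_mul_of_pos_left i2 (mul_pos hB hp)
  linarith

theorem rateFun_neg_zero_unique {A B p q r x y : ℝ} (hA : 0 < A) (hB : 0 < B) (hp : 0 < p)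
    (hq : 0 < q) (hr : q < r) (hxy : x < y) (hy0 : y < 0)
    (hx : rateFun A B p q r x = 0) (hy : rateFun A B p q r y = 0) : False := by
  have hc := continuous_rateFun A B p q r
  obtain ⟨u, hu, hu'⟩ := exists_hasDerivAt_eq_zero hxy hc.continuousOn (hx.trans hy.symm)
    (fun z _ => hasDerivAt_rateFun A B p q r z)
  obtain ⟨v, hv, hv'⟩ := exists_hasDerivAt_eq_zero hy0 hc.continuousOn
    (hy.trans (rateFun_zero A B p q r).symm) (fun z _ => hasDerivAt_rateFun A B p q r z)
  exact deriv_rateFun_zero_unique hA hB hp hq hr (hu.2.trans hv.1) hu' hv'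

open Topology in
theorem exists_rateFun_neg_zero {A B p q r : ℝ} (hA : 0 < A) (hB : 0 < B) (hp : 0 < p)
    (hq : 0 < q) (h : B * (p + q) < A * r) : ∃ k < 0, rateFun A B p q r k = 0 := by
  set k₁ : ℝ := -((A / B + 1) / p) with hk₁
  have hAB : 0 < A / B := div_pos hA hB
  have hk₁neg : k₁ < 0 := neg_neg_of_pos (by positivity)
  have hpos : 0 < rateFun A B p q r k₁ := by
    have e1 : k₁ * -p = A / B + 1 := by rw [hk₁]; field_simp
    have e2 : exp (k₁ * q) < 1 := exp_lt_one_iff.mpr (mul_neg_of_neg_of_pos hk₁neg hq)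
    have e3 := add_one_le_exp (A / B + 1)
    have e4 : B * (A / B) = A := by field_simp
    have e5 : B * (A / B) < B * (exp (k₁ * -p) - exp (k₁ * q)) :=
      mul_lt_mul_of_pos_left (by rw [e1]; linarith) hB
    have e6 := mul_pos hA (exp_pos (k₁ * r))
    unfold rateFun
    linarith
  have hd : HasDerivAt (rateFun A B p q r) (A * r - B * (p + q)) 0 := by
    convert hasDerivAt_rateFun A B p q r 0 using 1
    simp
    ring
  have hslope := (hasDerivAt_iff_tendsto_slope.mp hd).eventually (lt_mem_nhds (sub_pos.mpr h))
  have hleft : ∀ᶠ z in 𝓝[<] (0 : ℝ), _ := hslope.filter_mono (nhdsWithin_mono 0 fun z (hz : z < 0) => hz.ne)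
  obtain ⟨k₂, hs, hk₂⟩ := (hleft.and (Ioo_mem_nhdsLT hk₁neg)).exists
  have hneg : rateFun A B p q r k₂ < 0 := by
    rw [slope_def_field, rateFun_zero, sub_zero, sub_zero] at hs
    by_contra hcon
    exact absurd hs (not_lt.mpr (div_nonpos_of_nonneg_of_nonpos (not_lt.mp hcon) hk₂.2.le))
  obtain ⟨k, hk, hk0⟩ := intermediate_value_Icc' hk₂.1.le
    (continuous_rateFun A B p q r).continuousOn ⟨hneg.le, hpos.le⟩
  exact ⟨k, hk.2.trans_lt hk₂.2, hk0⟩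

theorem rateFun_mul_exp (A B t₀ t₁ t₂ t₃ k : ℝ) :
    rateFun A B (t₁ - t₀) (t₂ - t₁) (t₃ - t₁) k * exp (k * t₁) =
      B * (exp (k * t₀) - exp (k * t₂)) - A * (exp (k * t₁) - exp (k * t₃)) := by
  have e : ∀ s, exp (k * (s - t₁)) * exp (k * t₁) = exp (k * s) := fun s => by
    rw [← exp_add]; ring_nf
  unfold rateFun
  rw [neg_sub]
  linear_combination B * e t₀ - B * e t₂ + A * e t₃

/-- For a dataset with `n = 4` such that
`(T₁−T₃)/(t₃−t₁) > (T₂−T₄)/(t₄−t₂) > 0`, there is a unique triple `(a,k,b)` with `a > 0`,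
`k < 0` such that `f(t) = a·exp(k·t)+b` equioscillates:
`T₁−f(t₁) = −(T₂−f(t₂)) = T₃−f(t₃) = −(T₄−f(t₄))`. -/
theorem stmt_2 (t T : Fin 4 → ℝ) (ht : StrictMono t)
    (h1 : (T 0 - T 2) / (t 2 - t 0) > (T 1 - T 3) / (t 3 - t 1))
    (h2 : (T 1 - T 3) / (t 3 - t 1) > 0) :
    ∃! akb : ℝ × ℝ × ℝ, 0 < akb.1 ∧ akb.2.1 < 0 ∧
      (T 0 - (akb.1 * Real.exp (akb.2.1 * t 0) + akb.2.2)
          = -(T 1 - (akb.1 * Real.exp (akb.2.1 * t 1) + akb.2.2)) ∧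
        T 0 - (akb.1 * Real.exp (akb.2.1 * t 0) + akb.2.2)
          = T 2 - (akb.1 * Real.exp (akb.2.1 * t 2) + akb.2.2) ∧
        T 0 - (akb.1 * Real.exp (akb.2.1 * t 0) + akb.2.2)
          = -(T 3 - (akb.1 * Real.exp (akb.2.1 * t 3) + akb.2.2))) := by
  have h01 : t 0 < t 1 := ht (by decide)
  have h12 : t 1 < t 2 := ht (by decide)
  have h23 : t 2 < t 3 := ht (by decide)
  have h31 : 0 < t 3 - t 1 := by linarith
  have h20 : 0 < t 2 - t 0 := by linarith
  have hB : 0 < T 1 - T 3 := (div_pos_iff_of_pos_right h31).mp h2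
  have hA : 0 < T 0 - T 2 := (div_pos_iff_of_pos_right h20).mp (h2.trans h1)
  have hAB : (T 1 - T 3) * (t 2 - t 0) < (T 0 - T 2) * (t 3 - t 1) :=
    (div_lt_div_iff₀ h31 h20).mp h1
  have hp : 0 < t 1 - t 0 := sub_pos.mpr h01
  have hq : 0 < t 2 - t 1 := sub_pos.mpr h12
  have hr : t 2 - t 1 < t 3 - t 1 := by linarith
  have hE : ∀ k < 0, 0 < exp (k * t 1) - exp (k * t 3) := fun k hk =>
    sub_pos.mpr (exp_lt_exp.mpr (mul_lt_mul_of_neg_left (h12.trans h23) hk))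
  obtain ⟨k, hk, hk0⟩ := exists_rateFun_neg_zero hA hB hp hq (r := t 3 - t 1)
    (by linarith)
  have huniq : ∀ k' < 0, rateFun (T 0 - T 2) (T 1 - T 3) (t 1 - t 0) (t 2 - t 1) (t 3 - t 1) k' = 0 →
      k' = k := by
    intro k' hk' hk'0
    rcases lt_trichotomy k' k with hlt | heq | hgt
    · exact (rateFun_neg_zero_unique hA hB hp hq hr hlt hk hk'0 hk0).elim
    · exact heq
    · exact (rateFun_neg_zero_unique hA hB hp hq hr hgt hk' hk0 hk'0).elim
  have hDk := hE k hk
  obtain ⟨a, ha⟩ : ∃ a, a * (exp (k * t 1) - exp (k * t 3)) = T 1 - T 3 :=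
    ⟨_, div_mul_cancel₀ _ hDk.ne'⟩
  have hapos : 0 < a := pos_of_mul_pos_left (ha ▸ hB) hDk.le
  have ha' : a * (exp (k * t 0) - exp (k * t 2)) = T 0 - T 2 := by
    have hrel := rateFun_mul_exp (T 0 - T 2) (T 1 - T 3) (t 0) (t 1) (t 2) (t 3) k
    rw [hk0, zero_mul] at hrel
    apply mul_right_cancel₀ hDk.ne'
    linear_combination (exp (k * t 0) - exp (k * t 2)) * ha - hrel
  refine ⟨(a, k, (T 0 + T 1 - a * exp (k * t 0) - a * exp (k * t 1)) / 2),
    ⟨hapos, hk, ?_, ?_, ?_⟩, ?_⟩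
  · ring
  · linear_combination -ha'
  · linear_combination ha
  · rintro ⟨a', k', b'⟩ ⟨-, hk', g1, g2, g3⟩
    dsimp only at hk' g1 g2 g3
    have f1 : a' * (exp (k' * t 0) - exp (k' * t 2)) = T 0 - T 2 := by linear_combination -g2
    have f2 : a' * (exp (k' * t 1) - exp (k' * t 3)) = T 1 - T 3 := by
      linear_combination g3 - g1
    obtain rfl : k' = k := by
      refine huniq k' hk' ((mul_eq_zero_iff_right (exp_pos (k' * t 1)).ne').mp ?_)
      rw [rateFun_mul_exp]
      linear_combination (exp (k' * t 1) - exp (k' * t 3)) * f1 -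
        (exp (k' * t 0) - exp (k' * t 2)) * f2
    obtain rfl : a' = a := mul_right_cancel₀ hDk.ne' (f2.trans ha.symm)
    have hb : b' = (T 0 + T 1 - a' * exp (k' * t 0) - a' * exp (k' * t 1)) / 2 := by
      linear_combination -g1 / 2
    rw [hb]
end

section
/- Let (𝔱,T) be a dataset with n = 4 such that (T_1−T_3)/(t_3−t_1) > (T_2−T_4)/(t_4−t_2) > 0, and let f(t) = a·exp(k·t)+b with a > 0, k < 0 satisfy T_1−f(t_1) = −(T_2−f(t_2)) = T_3−f(t_3) = −(T_4−f(t_4)). Then for every exponential g with g ≠ f (as functions on ℝ) one has E(g) > E(f); in particular f is the unique best exponential approximation to (𝔱,T). -/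
open Real

/-- A function is an exponential if it has the form `t ↦ a·exp(k·t)+b` with `k ≠ 0`. -/
def IsExp (g : ℝ → ℝ) : Prop :=
  ∃ a b k : ℝ, k ≠ 0 ∧ g = fun s => a * Real.exp (k * s) + b

/-- Max-norm approximation error of `f` on the dataset `(t, T)`. -/
noncomputable def approxErr {n : ℕ} (t T : Fin n → ℝ) (f : ℝ → ℝ) : ℝ :=
  ⨆ i : Fin n, |f (t i) - T i|

/-- A function `c·exp(r·x) + d` whose signs at three increasing points are weakly `-`, `+`, `-`
vanishes identically. -/
lemma exp_add_const_eq_zero_of_alternating {c d r x y z : ℝ} (hxy : x < y) (hyz : y < z)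
    (hx : c * exp (r * x) + d ≤ 0) (hy : 0 ≤ c * exp (r * y) + d)
    (hz : c * exp (r * z) + d ≤ 0) (s : ℝ) : c * exp (r * s) + d = 0 := by
  rcases lt_trichotomy r 0 with hr | rfl | hr
  · have hxy' : exp (r * y) < exp (r * x) := exp_lt_exp.2 (mul_lt_mul_of_neg_left hxy hr)
    have hyz' : exp (r * z) < exp (r * y) := exp_lt_exp.2 (mul_lt_mul_of_neg_left hyz hr)
    have hc : c = 0 := le_antisymm (by nlinarith) (by nlinarith)
    subst hc
    linarith
  · simp only [zero_mul, exp_zero] at *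
    linarith
  · have hxy' : exp (r * x) < exp (r * y) := exp_lt_exp.2 (mul_lt_mul_of_pos_left hxy hr)
    have hyz' : exp (r * y) < exp (r * z) := exp_lt_exp.2 (mul_lt_mul_of_pos_left hyz hr)
    have hc : c = 0 := le_antisymm (by nlinarith) (by nlinarith)
    subst hc
    linarith

/-- A combination of two exponentials and a constant whose signs at four increasing points are
weakly `+`, `-`, `+`, `-` vanishes identically. -/
lemma exp_add_exp_add_const_eq_zero_of_alternating {A B C p q t₀ t₁ t₂ t₃ : ℝ} {h : ℝ → ℝ}
    (hh : h = fun s => A * exp (p * s) + B * exp (q * s) + C)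
    (h01 : t₀ < t₁) (h12 : t₁ < t₂) (h23 : t₂ < t₃)
    (h0 : 0 ≤ h t₀) (h1 : h t₁ ≤ 0) (h2 : 0 ≤ h t₂) (h3 : h t₃ ≤ 0) (s : ℝ) : h s = 0 := by
  have hderiv (x : ℝ) :
      HasDerivAt h (exp (q * x) * (A * p * exp ((p - q) * x) + B * q)) x := by
    have hexp (u : ℝ) : HasDerivAt (fun s => exp (u * s)) (exp (u * x) * u) x := by
      simpa using ((hasDerivAt_id x).const_mul u).exp
    rw [hh]
    refine ((((hexp p).const_mul A).add ((hexp q).const_mul B)).add_const C).congr_deriv ?_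
    rw [show p * x = q * x + (p - q) * x by ring, exp_add]
    ring
  have hcont : Continuous h := continuous_iff_continuousAt.2 fun x => (hderiv x).continuousAt
  obtain ⟨x, ⟨-, hx1⟩, hx⟩ :=
    exists_hasDerivAt_eq_slope h _ h01 hcont.continuousOn fun x _ => hderiv x
  obtain ⟨y, ⟨hy0, hy1⟩, hy⟩ :=
    exists_hasDerivAt_eq_slope h _ h12 hcont.continuousOn fun x _ => hderiv x
  obtain ⟨z, ⟨hz0, -⟩, hz⟩ :=
    exists_hasDerivAt_eq_slope h _ h23 hcont.continuousOn fun x _ => hderiv x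
  have hx' := hx.trans_le (div_nonpos_of_nonpos_of_nonneg (by linarith) (by linarith))
  have hy' := hy.symm ▸ div_nonneg (sub_nonneg.2 (h1.trans h2)) (sub_nonneg.2 h12.le)
  have hz' := hz.trans_le (div_nonpos_of_nonpos_of_nonneg (by linarith) (by linarith))
  have hzero := exp_add_const_eq_zero_of_alternating (hx1.trans hy0) (hy1.trans hz0)
    (nonpos_of_mul_nonpos_right hx' (exp_pos _))
    (nonneg_of_mul_nonneg_right hy' (exp_pos _))
    (nonpos_of_mul_nonpos_right hz' (exp_pos _))
  have hconst := is_const_of_deriv_eq_zero (fun x => (hderiv x).differentiableAt)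
    fun x => by rw [(hderiv x).deriv, hzero, mul_zero]
  exact le_antisymm ((hconst s t₁).trans_le h1) (h0.trans_eq (hconst t₀ s))

lemma abs_sub_le_approxErr {n : ℕ} (t T : Fin n → ℝ) (f : ℝ → ℝ) (i : Fin n) :
    |f (t i) - T i| ≤ approxErr t T f :=
  le_ciSup (f := fun i => |f (t i) - T i|) (Set.finite_range _).bddAbove i

/-- Under the conditions of Lemma 44, the equioscillating exponential `f`
with `a > 0`, `k < 0` is the unique best exponential approximation: every exponential
`g ≠ f` has strictly larger error. -/
theorem stmt_3 (t T : Fin 4 → ℝ) (ht : StrictMono t)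
    (h1 : (T 0 - T 2) / (t 2 - t 0) > (T 1 - T 3) / (t 3 - t 1))
    (h2 : (T 1 - T 3) / (t 3 - t 1) > 0)
    (a k b : ℝ) (ha : 0 < a) (hk : k < 0)
    (f : ℝ → ℝ) (hf : f = fun s => a * Real.exp (k * s) + b)
    (e1 : T 0 - f (t 0) = -(T 1 - f (t 1)))
    (e2 : T 0 - f (t 0) = T 2 - f (t 2))
    (e3 : T 0 - f (t 0) = -(T 3 - f (t 3))) :
    ∀ g : ℝ → ℝ, IsExp g → g ≠ f → approxErr t T f < approxErr t T g := by
  rintro g ⟨a', b', k', -, hg⟩ hne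
  by_contra! hle
  obtain ⟨e, he⟩ : ∃ e, e = T 0 - f (t 0) := ⟨_, rfl⟩
  have hEf : approxErr t T f = |e| := by
    have hi (i : Fin 4) : |f (t i) - T i| = |e| := by
      rw [abs_eq_abs]
      fin_cases i <;> simp only [Fin.zero_eta, Fin.mk_one, Fin.reduceFinMk]
      · right; linarith
      · left; linarith
      · right; linarith
      · left; linarith
    simp only [approxErr, hi, ciSup_const]
  have hg' (i : Fin 4) := abs_le.1 ((abs_sub_le_approxErr t T g i).trans (hle.trans_eq hEf))
  have h01 : t 0 < t 1 := ht (by decide)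
  have h12 : t 1 < t 2 := ht (by decide)
  have h23 : t 2 < t 3 := ht (by decide)
  obtain ⟨hl0, hu0⟩ := hg' 0
  obtain ⟨hl1, hu1⟩ := hg' 1
  obtain ⟨hl2, hu2⟩ := hg' 2
  obtain ⟨hl3, hu3⟩ := hg' 3
  apply hne
  funext s
  rcases le_total 0 e with hs | hs
  · rw [abs_of_nonneg hs] at *
    refine sub_eq_zero.1 (exp_add_exp_add_const_eq_zero_of_alternating
      (h := fun s => g s - f s) (A := a') (B := -a) (C := b' - b) (p := k') (q := k)
      ?_ h01 h12 h23 ?_ ?_ ?_ ?_ s)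
    · funext x; simp only [hg, hf]; ring
    all_goals linarith
  · rw [abs_of_nonpos hs] at *
    refine (sub_eq_zero.1 (exp_add_exp_add_const_eq_zero_of_alternating
      (h := fun s => f s - g s) (A := a) (B := -a') (C := b - b') (p := k) (q := k')
      ?_ h01 h12 h23 ?_ ?_ ?_ ?_ s)).symm
    · funext x; simp only [hg, hf]; ring
    all_goals linarith
end

section
/- Let (𝔱,T) be a dataset with n = 4 such that (T_2−T_4)/(t_4−t_2) < (T_1−T_3)/(t_3−t_1) < 0. Then there exists a unique triple (a,k,b) ∈ ℝ³ with a > 0 and k > 0 such that the function f(t) = a·exp(k·t)+b satisfies T_1−f(t_1) = −(T_2−f(t_2)) = T_3−f(t_3) = −(T_4−f(t_4)), and this f satisfies E(f) < E(g) for every exponential g ≠ f. -/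
open Real

/-- A nonconstant exponential sum `p·exp(k·x) + q·exp(l·x) + c` that weakly alternates in sign at
four increasing points vanishes identically. -/
theorem exp_sum_eq_zero_of_alternating {p q c k l x₀ x₁ x₂ x₃ : ℝ} (hp : p ≠ 0) (hk : k ≠ 0)
    (h₀₁ : x₀ < x₁) (h₁₂ : x₁ < x₂) (h₂₃ : x₂ < x₃)
    (d₀ : 0 ≤ p * exp (k * x₀) + q * exp (l * x₀) + c)
    (d₁ : p * exp (k * x₁) + q * exp (l * x₁) + c ≤ 0)
    (d₂ : 0 ≤ p * exp (k * x₂) + q * exp (l * x₂) + c)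
    (d₃ : p * exp (k * x₃) + q * exp (l * x₃) + c ≤ 0) :
    k = l ∧ q = -p ∧ c = 0 := by
  set d : ℝ → ℝ := fun x => p * exp (k * x) + q * exp (l * x) + c with hd
  set φ : ℝ → ℝ := fun x => p * k * exp ((k - l) * x) + q * l with hφ
  have hderiv : ∀ x, HasDerivAt d (exp (l * x) * φ x) x := by
    intro x
    have e (m : ℝ) : HasDerivAt (fun x => exp (m * x)) (exp (m * x) * m) x := by
      simpa using ((hasDerivAt_id x).const_mul m).exp
    have : exp (k * x) = exp (l * x) * exp ((k - l) * x) := by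
      rw [← exp_add]; ring_nf
    refine ((((e k).const_mul p).add ((e l).const_mul q)).add_const c).congr_deriv ?_
    rw [this]; ring
  have mvt : ∀ {x y : ℝ}, x < y → ∃ s, x < s ∧ s < y ∧ exp (l * s) * φ s * (y - x) = d y - d x := by
    intro x y hxy
    obtain ⟨s, hs, h⟩ := exists_hasDerivAt_eq_slope d (fun s => exp (l * s) * φ s) hxy
      (fun z _ => (hderiv z).continuousAt.continuousWithinAt) (fun z _ => hderiv z)
    exact ⟨s, hs.1, hs.2, by rw [h, div_mul_cancel₀ _ (sub_pos.2 hxy).ne']⟩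
  have nonpos : ∀ {x y : ℝ}, x < y → 0 ≤ d x → d y ≤ 0 → ∃ s, x < s ∧ s < y ∧ φ s ≤ 0 := by
    intro x y hxy hx hy
    obtain ⟨s, h1, h2, h⟩ := mvt hxy
    refine ⟨s, h1, h2, not_lt.1 fun hpos => ?_⟩
    have := mul_pos (mul_pos (exp_pos (l * s)) hpos) (sub_pos.2 hxy)
    linarith
  obtain ⟨s₀, -, hs₀, φ₀⟩ := nonpos h₀₁ d₀ d₁
  obtain ⟨s₂, hs₂, -, φ₂⟩ := nonpos h₂₃ d₂ d₃
  obtain ⟨s₁, hs₁, hs₁', h⟩ := mvt h₁₂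
  have φ₁ : 0 ≤ φ s₁ := not_lt.1 fun hneg => by
    have := mul_neg_of_neg_of_pos (mul_neg_of_pos_of_neg (exp_pos (l * s₁)) hneg)
      (sub_pos.2 h₁₂)
    simp only [hd] at h
    linarith
  have h01 : s₀ < s₁ := hs₀.trans hs₁
  have h12 : s₁ < s₂ := hs₁'.trans hs₂
  have hmono : ∀ x y, exp ((k - l) * x) < exp ((k - l) * y) ↔ (k - l) * x < (k - l) * y :=
    fun x y => exp_lt_exp
  have hkl : k = l := by
    by_contra hne
    simp only [hφ] at φ₀ φ₁ φ₂
    rcases lt_or_gt_of_ne (sub_ne_zero.2 hne) with hlt | hlt <;>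
    rcases lt_or_gt_of_ne (mul_ne_zero hp hk) with hpk | hpk
    · have := (hmono s₂ s₁).2 (mul_lt_mul_of_neg_left h12 hlt)
      have := mul_lt_mul_of_neg_left this hpk
      linarith
    · have := (hmono s₁ s₀).2 (mul_lt_mul_of_neg_left h01 hlt)
      have := mul_lt_mul_of_pos_left this hpk
      linarith
    · have := (hmono s₀ s₁).2 (mul_lt_mul_of_pos_left h01 hlt)
      have := mul_lt_mul_of_neg_left this hpk
      linarith
    · have := (hmono s₁ s₂).2 (mul_lt_mul_of_pos_left h12 hlt)
      have := mul_lt_mul_of_pos_left this hpk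
      linarith
  subst hkl
  have hq : q = -p := by
    simp only [hφ, sub_self, zero_mul, exp_zero, mul_one] at φ₀ φ₁
    have : (p + q) * k = 0 := by linarith
    have := (mul_eq_zero.1 this).resolve_right hk
    linarith
  subst hq
  exact ⟨rfl, rfl, by linarith⟩

/-- Two exponentials whose difference weakly alternates in sign at four increasing points have the
same parameters. -/
theorem exp_params_eq_of_alternating {a b k a' b' k' x₀ x₁ x₂ x₃ : ℝ} (ha : a ≠ 0) (hk : k ≠ 0)
    (h₀₁ : x₀ < x₁) (h₁₂ : x₁ < x₂) (h₂₃ : x₂ < x₃)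
    (d₀ : a' * exp (k' * x₀) + b' ≤ a * exp (k * x₀) + b)
    (d₁ : a * exp (k * x₁) + b ≤ a' * exp (k' * x₁) + b')
    (d₂ : a' * exp (k' * x₂) + b' ≤ a * exp (k * x₂) + b)
    (d₃ : a * exp (k * x₃) + b ≤ a' * exp (k' * x₃) + b') :
    a = a' ∧ k = k' ∧ b = b' := by
  obtain ⟨h1, h2, h3⟩ := exp_sum_eq_zero_of_alternating (q := -a') (l := k') (c := b - b') ha hk
    h₀₁ h₁₂ h₂₃ (by linarith) (by linarith) (by linarith) (by linarith)
  exact ⟨by linarith, h1, by linarith⟩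

/-- The variant of `exp_params_eq_of_alternating` with the opposite signs. -/
theorem exp_params_eq_of_alternating' {a b k a' b' k' x₀ x₁ x₂ x₃ : ℝ} (ha : a ≠ 0) (hk : k ≠ 0)
    (h₀₁ : x₀ < x₁) (h₁₂ : x₁ < x₂) (h₂₃ : x₂ < x₃)
    (d₀ : a * exp (k * x₀) + b ≤ a' * exp (k' * x₀) + b')
    (d₁ : a' * exp (k' * x₁) + b' ≤ a * exp (k * x₁) + b)
    (d₂ : a * exp (k * x₂) + b ≤ a' * exp (k' * x₂) + b')
    (d₃ : a' * exp (k' * x₃) + b' ≤ a * exp (k * x₃) + b) :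
    a = a' ∧ k = k' ∧ b = b' := by
  obtain ⟨h1, h2, h3⟩ := exp_sum_eq_zero_of_alternating (p := -a) (q := a') (l := k')
    (c := b' - b) (neg_ne_zero.2 ha) hk h₀₁ h₁₂ h₂₃
    (by linarith) (by linarith) (by linarith) (by linarith)
  exact ⟨by linarith, h1, by linarith⟩

/-- An exponential equioscillating on four points is strictly better than any other one. -/
theorem approxErr_lt_of_equioscillation {t T : Fin 4 → ℝ} (ht : StrictMono t) {a k b : ℝ}
    (ha : a ≠ 0) (hk : k ≠ 0) {f : ℝ → ℝ} (hf : f = fun s => a * exp (k * s) + b)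
    (e₁ : T 0 - f (t 0) = -(T 1 - f (t 1))) (e₂ : T 0 - f (t 0) = T 2 - f (t 2))
    (e₃ : T 0 - f (t 0) = -(T 3 - f (t 3))) {g : ℝ → ℝ} (hg : IsExp g) (hgf : g ≠ f) :
    approxErr t T f < approxErr t T g := by
  by_contra! hle
  have hfE : approxErr t T f ≤ |T 0 - f (t 0)| := by
    refine ciSup_le fun i => le_of_eq ?_
    rw [abs_sub_comm]
    fin_cases i
    · rfl
    · exact (by rw [e₁, abs_neg] : |T 1 - f (t 1)| = |T 0 - f (t 0)|)
    · exact (by rw [e₂] : |T 2 - f (t 2)| = |T 0 - f (t 0)|)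
    · exact (by rw [e₃, abs_neg] : |T 3 - f (t 3)| = |T 0 - f (t 0)|)
  have hgE : ∀ i, |g (t i) - T i| ≤ |T 0 - f (t 0)| := fun i =>
    (le_ciSup (f := fun i => |g (t i) - T i|) (Set.finite_range _).bddAbove i).trans
      (hle.trans hfE)
  have g₀ := abs_le.1 (hgE 0)
  have g₁ := abs_le.1 (hgE 1)
  have g₂ := abs_le.1 (hgE 2)
  have g₃ := abs_le.1 (hgE 3)
  have h₀₁ : t 0 < t 1 := ht (by decide)
  have h₁₂ : t 1 < t 2 := ht (by decide)
  have h₂₃ : t 2 < t 3 := ht (by decide)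
  obtain ⟨a', b', k', -, rfl⟩ := hg
  subst hf
  have hpar : a = a' ∧ k = k' ∧ b = b' := by
    rcases abs_cases (T 0 - (a * exp (k * t 0) + b)) with ⟨h, -⟩ | ⟨h, -⟩ <;>
      simp only [h] at g₀ g₁ g₂ g₃ e₁ e₂ e₃
    · apply exp_params_eq_of_alternating' ha hk h₀₁ h₁₂ h₂₃ <;> linarith
    · apply exp_params_eq_of_alternating ha hk h₀₁ h₁₂ h₂₃ <;> linarith
  obtain ⟨rfl, rfl, rfl⟩ := hpar
  exact hgf rfl

/-- If the slope `D₂ / (x₃ - x₁)` exceeds `D₁ / (x₂ - x₀)`, some positive rate realises both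
increments `D₁`, `D₂` up to a common factor. -/
theorem exists_rate {x₀ x₁ x₂ x₃ D₁ D₂ : ℝ} (h₁₂ : x₁ < x₂) (h₂₃ : x₂ < x₃)
    (hD₁ : 0 < D₁) (hD₂ : 0 < D₂) (h : D₁ * (x₃ - x₁) < D₂ * (x₂ - x₀)) :
    ∃ k, 0 < k ∧
      D₁ * (exp (k * x₃) - exp (k * x₁)) = D₂ * (exp (k * x₂) - exp (k * x₀)) := by
  set G : ℝ → ℝ := fun k =>
    D₁ * (exp (k * x₃) - exp (k * x₁)) - D₂ * (exp (k * x₂) - exp (k * x₀)) with hG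
  have hG0 : G 0 = 0 := by simp [hG]
  have hder : HasDerivAt G (D₁ * (x₃ - x₁) - D₂ * (x₂ - x₀)) 0 := by
    have e (m : ℝ) : HasDerivAt (fun k => exp (k * m)) m 0 := by
      simpa using ((hasDerivAt_id (0 : ℝ)).mul_const m).exp
    exact (((e x₃).sub (e x₁)).const_mul D₁).sub (((e x₂).sub (e x₀)).const_mul D₂)
  obtain ⟨u, hu, hGu⟩ : ∃ u, 0 < u ∧ G u < 0 := by
    have hev := (hasDerivAt_iff_tendsto_slope.1 hder).eventually (gt_mem_nhds (sub_neg.2 h))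
    have hev' := hev.filter_mono
      (nhdsWithin_mono (0 : ℝ) (fun x hx => (Set.mem_Ioi.1 hx).ne' : Set.Ioi (0 : ℝ) ⊆ {0}ᶜ))
    obtain ⟨u, hslope, hu⟩ := (hev'.and (self_mem_nhdsWithin (s := Set.Ioi (0 : ℝ)))).exists
    have hu : 0 < u := hu
    refine ⟨u, hu, ?_⟩
    rw [slope_def_field, hG0, sub_zero, sub_zero] at hslope
    exact (div_neg_iff.1 hslope).elim (fun h => absurd h.2 hu.not_gt) And.left
  obtain ⟨v, hv, hGv⟩ : ∃ v, 0 < v ∧ 0 < G v := by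
    have h23 := sub_pos.2 h₂₃
    refine ⟨D₂ / (D₁ * (x₃ - x₂)), by positivity, ?_⟩
    set v := D₂ / (D₁ * (x₃ - x₂)) with hv
    have hvpos : 0 < v := by positivity
    have hv' : D₁ * (v * (x₃ - x₂)) = D₂ := by rw [hv]; field_simp
    have hlin := add_one_le_exp (v * (x₃ - x₂))
    have hsplit : exp (v * x₃) = exp (v * x₂) * exp (v * (x₃ - x₂)) := by
      rw [← exp_add]; ring_nf
    have h12 : exp (v * x₁) < exp (v * x₂) := exp_lt_exp.2 (mul_lt_mul_of_pos_left h₁₂ hvpos)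
    have key : D₂ * exp (v * x₂) ≤ D₁ * (exp (v * x₃) - exp (v * x₂)) := by
      rw [hsplit, ← hv']
      have := mul_le_mul_of_nonneg_left hlin (mul_pos hD₁ (exp_pos (v * x₂))).le
      linarith
    have := mul_pos hD₂ (exp_pos (v * x₀))
    have := mul_lt_mul_of_pos_left h12 hD₁
    simp only [hG]
    linarith
  have hcont : ContinuousOn G (Set.Ioi 0) := by
    simp only [hG]; fun_prop
  obtain ⟨k, hk, hGk⟩ := isPreconnected_Ioi.intermediate_value (Set.mem_Ioi.2 hu)
    (Set.mem_Ioi.2 hv) hcont ⟨hGu.le, hGv.le⟩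
  exact ⟨k, hk, sub_eq_zero.1 hGk⟩

/-- symmetric case: if `(T₂−T₄)/(t₄−t₂) < (T₁−T₃)/(t₃−t₁) < 0`, there is a
unique triple `(a,k,b)` with `a > 0`, `k > 0` whose exponential equioscillates, and any
such exponential beats every other exponential strictly. -/
theorem stmt_4 (t T : Fin 4 → ℝ) (ht : StrictMono t)
    (h1 : (T 1 - T 3) / (t 3 - t 1) < (T 0 - T 2) / (t 2 - t 0))
    (h2 : (T 0 - T 2) / (t 2 - t 0) < 0) :
    (∃! akb : ℝ × ℝ × ℝ, 0 < akb.1 ∧ 0 < akb.2.1 ∧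
      (T 0 - (akb.1 * Real.exp (akb.2.1 * t 0) + akb.2.2)
          = -(T 1 - (akb.1 * Real.exp (akb.2.1 * t 1) + akb.2.2)) ∧
        T 0 - (akb.1 * Real.exp (akb.2.1 * t 0) + akb.2.2)
          = T 2 - (akb.1 * Real.exp (akb.2.1 * t 2) + akb.2.2) ∧
        T 0 - (akb.1 * Real.exp (akb.2.1 * t 0) + akb.2.2)
          = -(T 3 - (akb.1 * Real.exp (akb.2.1 * t 3) + akb.2.2)))) ∧
    (∀ a k b : ℝ, 0 < a → 0 < k →
      ∀ f : ℝ → ℝ, f = (fun s => a * Real.exp (k * s) + b) →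
      T 0 - f (t 0) = -(T 1 - f (t 1)) →
      T 0 - f (t 0) = T 2 - f (t 2) →
      T 0 - f (t 0) = -(T 3 - f (t 3)) →
      ∀ g : ℝ → ℝ, IsExp g → g ≠ f → approxErr t T f < approxErr t T g) := by
  have h₀₁ : t 0 < t 1 := ht (by decide)
  have h₁₂ : t 1 < t 2 := ht (by decide)
  have h₂₃ : t 2 < t 3 := ht (by decide)
  have h20 : 0 < t 2 - t 0 := by linarith
  have h31 : 0 < t 3 - t 1 := by linarith
  have hD₁ : 0 < T 2 - T 0 := by
    have := (div_lt_iff₀ h20).1 h2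
    linarith
  have hD₂ : 0 < T 3 - T 1 := by
    have := (div_lt_iff₀ h31).1 (h1.trans h2)
    linarith
  have hslope : (T 2 - T 0) * (t 3 - t 1) < (T 3 - T 1) * (t 2 - t 0) := by
    have := (div_lt_div_iff₀ h31 h20).1 h1
    linarith
  refine ⟨?_, fun a k b ha hk f hf e₁ e₂ e₃ g hg hgf =>
    approxErr_lt_of_equioscillation ht ha.ne' hk.ne' hf e₁ e₂ e₃ hg hgf⟩
  refine existsUnique_of_exists_of_unique ?_ ?_
  · obtain ⟨k, hk, hrate⟩ := exists_rate h₁₂ h₂₃ hD₁ hD₂ hslope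
    have hpos : 0 < exp (k * t 2) - exp (k * t 0) :=
      sub_pos.2 (exp_lt_exp.2 (mul_lt_mul_of_pos_left (h₀₁.trans h₁₂) hk))
    obtain ⟨a, ha⟩ : ∃ a, a = (T 2 - T 0) / (exp (k * t 2) - exp (k * t 0)) := ⟨_, rfl⟩
    have hinc₁ : a * (exp (k * t 2) - exp (k * t 0)) = T 2 - T 0 := by
      rw [ha, div_mul_cancel₀ _ hpos.ne']
    have hinc₂ : a * (exp (k * t 3) - exp (k * t 1)) = T 3 - T 1 := by
      rw [ha, div_mul_eq_mul_div, hrate, mul_div_cancel_right₀ _ hpos.ne']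
    refine ⟨(a, k, (T 0 + T 1 - a * (exp (k * t 0) + exp (k * t 1))) / 2),
      by rw [ha]; exact div_pos hD₁ hpos, hk, ?_, ?_, ?_⟩ <;> dsimp only <;> linarith
  · rintro ⟨a, k, b⟩ ⟨a', k', b'⟩ ⟨ha, hk, e₁, e₂, e₃⟩ ⟨ha', hk', e₁', e₂', e₃'⟩
    dsimp only at ha hk e₁ e₂ e₃ ha' hk' e₁' e₂' e₃'
    have hpar : a = a' ∧ k = k' ∧ b = b' := by
      rcases le_total (a * exp (k * t 0) + b) (a' * exp (k' * t 0) + b') with h | h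
      · apply exp_params_eq_of_alternating' ha.ne' hk.ne' h₀₁ h₁₂ h₂₃ <;> linarith
      · apply exp_params_eq_of_alternating ha.ne' hk.ne' h₀₁ h₁₂ h₂₃ <;> linarith
    obtain ⟨rfl, rfl, rfl⟩ := hpar
    rfl
end

section
/- Let 0 < s_2 < s_3 < s_4 be real numbers and let A > 0, B > 0. Then the function q:(0,∞) → ℝ defined by q(z) = A·z^{s_4} − B·z^{s_3} − A·z^{s_2} + B has at most two zeros in (0,∞). -/
open Real

/-- A real power sum whose only sign change separates the top term from the other two vanishes at
most once on the positive axis. -/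
theorem rpow_trinomial_zero_unique {p q r a b c x y : ℝ} (hrq : r < q) (hqp : q < p)
    (ha : 0 < a) (hc : 0 < c) (hx : 0 < x) (hxy : x < y)
    (h0x : a * x ^ p - b * x ^ q - c * x ^ r = 0)
    (h0y : a * y ^ p - b * y ^ q - c * y ^ r = 0) : False := by
  have quotient {t : ℝ} (ht : 0 < t) (h : a * t ^ p - b * t ^ q - c * t ^ r = 0) :
      a * t ^ (p - q) - c * t ^ (r - q) = b := by
    have hq := rpow_pos_of_pos ht q
    rw [rpow_sub ht, rpow_sub ht]
    field_simp
    linarith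
  have hlt := mul_lt_mul_of_pos_left (rpow_lt_rpow hx.le hxy (sub_pos.2 hqp)) ha
  have hgt := mul_lt_mul_of_pos_left (rpow_lt_rpow_of_neg hx hxy (sub_neg.2 hrq)) hc
  linarith [quotient hx h0x, quotient (hx.trans hxy) h0y]

/-- Between two positive zeros of a real power sum with a constant term lies a zero of its
derivative. -/
theorem exists_rpow_deriv_zero {p q r a b c d x y : ℝ} (hx : 0 < x) (hxy : x < y)
    (h0x : a * x ^ p - b * x ^ q - c * x ^ r + d = 0)
    (h0y : a * y ^ p - b * y ^ q - c * y ^ r + d = 0) :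
    ∃ t, x < t ∧ t < y ∧
      a * p * t ^ (p - 1) - b * q * t ^ (q - 1) - c * r * t ^ (r - 1) = 0 := by
  have hderiv {t : ℝ} (ht : 0 < t) :
      HasDerivAt (fun z : ℝ => a * z ^ p - b * z ^ q - c * z ^ r + d)
        (a * p * t ^ (p - 1) - b * q * t ^ (q - 1) - c * r * t ^ (r - 1)) t := by
    have hpow (s : ℝ) : HasDerivAt (fun z : ℝ => z ^ s) (s * t ^ (s - 1)) t :=
      hasDerivAt_rpow_const (Or.inl ht.ne')
    exact (((((hpow p).const_mul a).sub ((hpow q).const_mul b)).sub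
      ((hpow r).const_mul c)).add_const d).congr_deriv (by ring)
  obtain ⟨t, ⟨hxt, hty⟩, ht⟩ := exists_hasDerivAt_eq_zero hxy
    (fun t ht => (hderiv (hx.trans_le ht.1)).continuousAt.continuousWithinAt)
    (h0x.trans h0y.symm) (fun t ht => hderiv (hx.trans ht.1))
  exact ⟨t, hxt, hty, ht⟩

/-- A set in a linear order without three increasing elements has at most two elements. -/
theorem Set.encard_le_two_of_forall_lt {α : Type*} [LinearOrder α] {S : Set α}
    (h : ∀ x ∈ S, ∀ y ∈ S, ∀ z ∈ S, x < y → y < z → False) : S.encard ≤ 2 := by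
  by_contra! hS
  have h_three : 3 ≤ S.encard := by
    have := Order.add_one_le_of_lt hS
    norm_num at this
    exact this
  obtain ⟨T, hTS, hT⟩ := Set.exists_subset_encard_eq h_three
  obtain ⟨x, y, z, hxy, hxz, hyz, rfl⟩ := Set.encard_eq_three.1 hT
  have hx : x ∈ S := hTS (by simp)
  have hy : y ∈ S := hTS (by simp)
  have hz : z ∈ S := hTS (by simp)
  rcases lt_or_gt_of_ne hxy with hxy | hxy <;> rcases lt_or_gt_of_ne hxz with hxz | hxz <;>
    rcases lt_or_gt_of_ne hyz with hyz | hyz <;> grind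

/-- Descartes-type bound: for `0 < s₂ < s₃ < s₄` and `A, B > 0`, the function
`q(z) = A·z^{s₄} − B·z^{s₃} − A·z^{s₂} + B` has at most two zeros in `(0,∞)`. -/
theorem stmt_5 (s₂ s₃ s₄ : ℝ) (h2 : 0 < s₂) (h23 : s₂ < s₃) (h34 : s₃ < s₄)
    (A B : ℝ) (hA : 0 < A) (hB : 0 < B) :
    {z : ℝ | 0 < z ∧ A * z ^ s₄ - B * z ^ s₃ - A * z ^ s₂ + B = 0}.encard ≤ 2 := by
  refine Set.encard_le_two_of_forall_lt ?_
  rintro x ⟨hx, h0x⟩ y ⟨hy, h0y⟩ z ⟨-, h0z⟩ hxy hyz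
  obtain ⟨t, hxt, hty, ht⟩ := exists_rpow_deriv_zero hx hxy h0x h0y
  obtain ⟨u, hyu, -, hu⟩ := exists_rpow_deriv_zero hy hyz h0y h0z
  exact rpow_trinomial_zero_unique (sub_lt_sub_right h23 1) (sub_lt_sub_right h34 1)
    (mul_pos hA (h2.trans (h23.trans h34))) (mul_pos hA h2) (hx.trans hxt) (hty.trans hyu) ht hu
end

section
/- Let (𝔱,T) be a dataset with n = 4 such that (T_1−T_3)/(t_3−t_1) > (T_2−T_4)/(t_4−t_2) > 0, and define p:(0,∞) → ℝ by p(z) = (T_1−T_3)·z^{t_4} − (T_2−T_4)·z^{t_3} − (T_1−T_3)·z^{t_2} + (T_2−T_4)·z^{t_1}. Then there exists exactly one z ∈ (0,1) with p(z) = 0. -/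
open Real

lemma hasDerivAt_four_term {A B a b c x : ℝ} (hx : 0 < x) :
    HasDerivAt (fun z : ℝ => A * z ^ c - B * z ^ b - A * z ^ a + B)
      (x ^ (b - 1) * (A * c * x ^ (c - b) - A * a * x ^ (a - b) - B * b)) x := by
  have h (s : ℝ) := Real.hasDerivAt_rpow_const (p := s) (Or.inl hx.ne')
  have hmul (s : ℝ) : x ^ (s - 1) = x ^ (b - 1) * x ^ (s - b) := by
    rw [← Real.rpow_add hx]; congr 1; ring
  refine (((((h c).const_mul A).sub ((h b).const_mul B)).sub
    ((h a).const_mul A)).add_const B).congr_deriv ?_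
  rw [hmul c, hmul a]; ring

lemma strictMonoOn_deriv_factor {A B a b c : ℝ} (hA : 0 < A) (ha : 0 < a) (hab : a < b)
    (hbc : b < c) :
    StrictMonoOn (fun x : ℝ => A * c * x ^ (c - b) - A * a * x ^ (a - b) - B * b)
      (Set.Ioi 0) := by
  intro x hx y _ hxy
  have hc : 0 < A * c := mul_pos hA (by linarith)
  have h1 := mul_lt_mul_of_pos_left
    (Real.rpow_lt_rpow (le_of_lt hx) hxy (sub_pos.2 hbc)) hc
  have h2 := mul_lt_mul_of_pos_left
    (Real.rpow_lt_rpow_of_neg hx hxy (sub_neg.2 hab)) (mul_pos hA ha)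
  dsimp only
  linarith

lemma existsUnique_zero_four_term {A B a b c : ℝ} (hA : 0 < A) (hB : 0 < B) (ha : 0 < a)
    (hab : a < b) (hbc : b < c) (h : B * b < A * (c - a)) :
    ∃! z : ℝ, z ∈ Set.Ioo (0 : ℝ) 1 ∧ A * z ^ c - B * z ^ b - A * z ^ a + B = 0 := by
  set q : ℝ → ℝ := fun z => A * z ^ c - B * z ^ b - A * z ^ a + B with hq
  have hcont : Continuous q := by
    have hs {s : ℝ} (hs : 0 < s) : Continuous fun z : ℝ => z ^ s :=
      Real.continuous_rpow_const hs.le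
    have := hs ha
    have := hs (ha.trans hab)
    have := hs ((ha.trans hab).trans hbc)
    fun_prop
  have hq0 : q 0 = B := by
    simp [hq, Real.zero_rpow ha.ne', Real.zero_rpow (ha.trans hab).ne',
      Real.zero_rpow ((ha.trans hab).trans hbc).ne']
  have hq1 : q 1 = 0 := by simp [hq]
  have hcrit {x y : ℝ} (hx : 0 < x) (hxy : x < y) (heq : q x = q y) :
      ∃ w ∈ Set.Ioo x y, A * c * w ^ (c - b) - A * a * w ^ (a - b) - B * b = 0 := by
    obtain ⟨w, hw, hw0⟩ := exists_hasDerivAt_eq_zero hxy hcont.continuousOn heq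
      (fun w hw => hasDerivAt_four_term (A := A) (B := B) (a := a) (b := b) (c := c)
        (hx.trans hw.1))
    exact ⟨w, hw, (mul_eq_zero.1 hw0).resolve_left
      (Real.rpow_pos_of_pos (hx.trans hw.1) _).ne'⟩
  have hunique {x y : ℝ} (hx : 0 < x) (hxy : x < y) (hy : y < 1) (hqx : q x = 0)
      (hqy : q y = 0) : False := by
    obtain ⟨v, hv, hv0⟩ := hcrit hx hxy (hqx.trans hqy.symm)
    obtain ⟨w, hw, hw0⟩ := hcrit (hx.trans hxy) hy (hqy.trans hq1.symm)
    exact (strictMonoOn_deriv_factor (B := B) hA ha hab hbc (hx.trans hv.1)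
      ((hx.trans hxy).trans hw.1) (hv.2.trans hw.1)).ne (hv0.trans hw0.symm)
  obtain ⟨y, hy, hqy⟩ : ∃ y ∈ Set.Ioo (0 : ℝ) 1, q y < 0 := by
    have hd := hasDerivAt_four_term (A := A) (B := B) (a := a) (b := b) (c := c) one_pos
    have hslope := hasDerivAt_iff_tendsto_slope_left_right.1 hd |>.1
    have hpos := hslope.eventually_const_lt (u := 0) (by simp; linarith)
    obtain ⟨y, hy, hy01⟩ :=
      (hpos.and (Ioo_mem_nhdsLT (zero_lt_one' ℝ))).exists
    refine ⟨y, hy01, ?_⟩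
    change 0 < slope q 1 y at hy
    rw [slope_def_field, hq1, sub_zero] at hy
    by_contra! hn
    exact hy.not_ge (div_nonpos_of_nonneg_of_nonpos hn (by linarith [hy01.2]))
  obtain ⟨z, hz, hqz⟩ := intermediate_value_Ioo' hy.1.le hcont.continuousOn
    (show (0 : ℝ) ∈ Set.Ioo (q y) (q 0) from ⟨hqy, hq0 ▸ hB⟩)
  refine ⟨z, ⟨⟨hz.1, hz.2.trans hy.2⟩, hqz⟩, ?_⟩
  rintro x ⟨hx, hqx⟩
  rcases lt_trichotomy x z with hlt | heq | hgt
  · exact (hunique hx.1 hlt (hz.2.trans hy.2) hqx hqz).elim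
  · exact heq
  · exact (hunique hz.1 hgt hx.2 hqz hqx).elim

/-- For a dataset with `n = 4` such that
`(T₁−T₃)/(t₃−t₁) > (T₂−T₄)/(t₄−t₂) > 0`, the function
`p(z) = (T₁−T₃)·z^{t₄} − (T₂−T₄)·z^{t₃} − (T₁−T₃)·z^{t₂} + (T₂−T₄)·z^{t₁}`
has exactly one zero in `(0,1)`. -/
theorem stmt_6 (t T : Fin 4 → ℝ) (ht : StrictMono t)
    (h1 : (T 0 - T 2) / (t 2 - t 0) > (T 1 - T 3) / (t 3 - t 1))
    (h2 : (T 1 - T 3) / (t 3 - t 1) > 0) :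
    ∃! z : ℝ, z ∈ Set.Ioo (0 : ℝ) 1 ∧
      (T 0 - T 2) * z ^ (t 3) - (T 1 - T 3) * z ^ (t 2)
        - (T 0 - T 2) * z ^ (t 1) + (T 1 - T 3) * z ^ (t 0) = 0 := by
  have h01 : t 0 < t 1 := ht (by decide)
  have h12 : t 1 < t 2 := ht (by decide)
  have h23 : t 2 < t 3 := ht (by decide)
  have hd : 0 < t 2 - t 0 := by linarith
  have hd' : 0 < t 3 - t 1 := by linarith
  have hB : 0 < T 1 - T 3 := (div_pos_iff_of_pos_right hd').1 h2
  have hA : 0 < T 0 - T 2 := (div_pos_iff_of_pos_right hd).1 (h2.trans h1)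
  have hAB : (T 1 - T 3) * (t 2 - t 0) < (T 0 - T 2) * ((t 3 - t 0) - (t 1 - t 0)) := by
    rw [sub_sub_sub_cancel_right]
    exact (div_lt_div_iff₀ hd' hd).1 h1
  refine (existsUnique_congr fun z => and_congr_right fun hz => ?_).1
    (existsUnique_zero_four_term hA hB (sub_pos.2 h01) (by linarith) (by linarith) hAB)
  have hmul (s : ℝ) : z ^ s = z ^ t 0 * z ^ (s - t 0) := by
    rw [← Real.rpow_add hz.1]; congr 1; ring
  rw [hmul (t 3), hmul (t 2), hmul (t 1),
    ← mul_eq_zero_iff_left (Real.rpow_pos_of_pos hz.1 (t 0)).ne']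
  ring_nf
end

section
/- Let (𝔱,T) be a dataset with n ≥ 3. For each k ≠ 0 there is a unique pair (a_k,b_k) minimizing (a,b) ↦ max_{1≤i≤n}|a·exp(k·t_i)+b−T_i|, and the maps k ↦ a_k, k ↦ b_k and k ↦ (a_k·exp(k·t_1)+b_k, …, a_k·exp(k·t_n)+b_k) are continuous on ℝ∖{0}. -/
open Real

open Filter Topology

/-- The uniform error of the affine function `s ↦ p.1 * s + p.2` on the data `(x, T)`. -/
noncomputable def affineError {ι : Type*} [Fintype ι] (x T : ι → ℝ) (p : ℝ × ℝ) : ℝ :=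
  ‖fun i => p.1 * x i + p.2 - T i‖

section

variable {ι : Type*} [Fintype ι] {x T : ι → ℝ}

lemma iSup_abs_eq_affineError [Nonempty ι] (x T : ι → ℝ) (a b : ℝ) :
    ⨆ i, |a * x i + b - T i| = affineError x T (a, b) := by
  refine le_antisymm (ciSup_le fun i => ?_) ?_
  · exact norm_le_pi_norm (fun i => a * x i + b - T i) i
  · refine (pi_norm_le_iff_of_nonempty _).2 fun i => ?_
    exact le_ciSup (f := fun i => |a * x i + b - T i|) (Set.finite_range _).bddAbove i

lemma abs_le_affineError (p : ℝ × ℝ) (i : ι) : |p.1 * x i + p.2 - T i| ≤ affineError x T p :=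
  norm_le_pi_norm (fun i => p.1 * x i + p.2 - T i) i

lemma exists_affineError_minimizer (x T : ι → ℝ) :
    ∃ p, ∀ q, affineError x T p ≤ affineError x T q := by
  let L : ℝ × ℝ →ₗ[ℝ] ι → ℝ :=
    { toFun := fun p i => p.1 * x i + p.2
      map_add' := fun p q => by ext i; simp only [Prod.fst_add, Prod.snd_add, Pi.add_apply]; ring
      map_smul' := fun c p => by
        ext i; simp only [Prod.smul_fst, Prod.smul_snd, smul_eq_mul, Pi.smul_apply,
          RingHom.id_apply]; ring }
  obtain ⟨_, ⟨p, rfl⟩, hp⟩ :=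
    (Submodule.closed_of_finiteDimensional (LinearMap.range L)).exists_infDist_eq_dist
      ⟨_, LinearMap.mem_range_self L 0⟩ T
  refine ⟨p, fun q => ?_⟩
  have hq := Metric.infDist_le_dist_of_mem (x := T) (LinearMap.mem_range_self L q)
  change Metric.infDist T (LinearMap.range L : Set (ι → ℝ)) ≤ _ at hq
  rw [hp, dist_comm, dist_comm T, dist_eq_norm, dist_eq_norm] at hq
  exact hq

/-- A minimizer attains its error at two distinct points at least. -/
lemma exists_ne_abs_eq_affineError [Nontrivial ι] {r : ℝ × ℝ}
    (hr : ∀ q, affineError x T r ≤ affineError x T q) :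
    ∃ i j, i ≠ j ∧ |r.1 * x i + r.2 - T i| = affineError x T r ∧
      |r.1 * x j + r.2 - T j| = affineError x T r := by
  by_contra! h
  obtain ⟨j, hj⟩ : ∃ j, ∀ i, i ≠ j → |r.1 * x i + r.2 - T i| < affineError x T r := by
    by_cases hex : ∃ j, |r.1 * x j + r.2 - T j| = affineError x T r
    · obtain ⟨j, hj⟩ := hex
      exact ⟨j, fun i hij => (abs_le_affineError r i).lt_of_ne (h j i hij.symm hj)⟩
    · push Not at hex
      exact ⟨Classical.arbitrary ι, fun i _ => (abs_le_affineError r i).lt_of_ne (hex i)⟩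
  obtain ⟨i₀, hi₀⟩ := exists_ne j
  have hpos : 0 < affineError x T r := (abs_nonneg _).trans_lt (hj i₀ hi₀)
  have hlt : ∀ᶠ ε in 𝓝[>] (0 : ℝ), ∀ i,
      |r.1 * x i + (r.2 - ε * (r.1 * x j + r.2 - T j)) - T i| < affineError x T r := by
    refine eventually_all.2 fun i => ?_
    by_cases hij : i = j
    · subst hij
      filter_upwards [Ioo_mem_nhdsGT (zero_lt_one (α := ℝ))] with ε hε
      have e : r.1 * x i + (r.2 - ε * (r.1 * x i + r.2 - T i)) - T i =
        (1 - ε) * (r.1 * x i + r.2 - T i) := by ring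
      rw [e, abs_mul, abs_of_pos (by linarith [hε.2])]
      have := abs_le_affineError (x := x) (T := T) r i
      nlinarith [hε.1, hε.2]
    · have hc : Continuous fun ε : ℝ =>
          |r.1 * x i + (r.2 - ε * (r.1 * x j + r.2 - T j)) - T i| := by fun_prop
      exact nhdsWithin_le_nhds (hc.continuousAt.eventually_lt_const (by simpa using hj i hij))
  obtain ⟨ε, hε⟩ := hlt.exists
  exact (hr (r.1, r.2 - ε * (r.1 * x j + r.2 - T j))).not_gt ((pi_norm_lt_iff hpos).2 hε)

lemma affineError_minimizer_unique [Nontrivial ι] (hx : Function.Injective x) {p q : ℝ × ℝ}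
    (hp : ∀ r, affineError x T p ≤ affineError x T r)
    (hq : ∀ r, affineError x T q ≤ affineError x T r) : p = q := by
  have hpq : affineError x T p = affineError x T q := (hp q).antisymm (hq p)
  set r : ℝ × ℝ := ((p.1 + q.1) / 2, (p.2 + q.2) / 2) with hr
  have hmid (i : ι) : r.1 * x i + r.2 - T i =
      ((p.1 * x i + p.2 - T i) + (q.1 * x i + q.2 - T i)) / 2 := by
    simp only [hr]; ring
  have hrp : affineError x T r = affineError x T p := by
    refine le_antisymm ((pi_norm_le_iff_of_nonempty _).2 fun i => ?_) (hp r)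
    rw [hmid, Real.norm_eq_abs, abs_le]
    have h₁ := abs_le.1 (abs_le_affineError (x := x) (T := T) p i)
    have h₂ := abs_le.1 (abs_le_affineError (x := x) (T := T) q i)
    constructor <;> linarith [h₁.1, h₁.2, h₂.1, h₂.2]
  have hagree (i : ι) (hi : |r.1 * x i + r.2 - T i| = affineError x T r) :
      p.1 * x i + p.2 = q.1 * x i + q.2 := by
    rw [hmid, hrp] at hi
    have h₁ := abs_le.1 (abs_le_affineError (x := x) (T := T) p i)
    have h₂ := abs_le.1 (abs_le_affineError (x := x) (T := T) q i)
    rcases abs_choice (((p.1 * x i + p.2 - T i) + (q.1 * x i + q.2 - T i)) / 2) with h | h <;>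
      rw [h] at hi <;> linarith [h₁.1, h₁.2, h₂.1, h₂.2]
  obtain ⟨i, j, hij, hi, hj⟩ :=
    exists_ne_abs_eq_affineError fun s => hrp.trans_le (hp s)
  have h₁ := hagree i hi
  have h₂ := hagree j hj
  have hmul : (p.1 - q.1) * (x i - x j) = 0 := by linarith
  have hfst : p.1 = q.1 :=
    sub_eq_zero.1 ((mul_eq_zero.1 hmul).resolve_right (sub_ne_zero.2 (hx.ne hij)))
  refine Prod.ext hfst ?_
  rw [hfst] at h₁
  linarith

/-- Minimizers of the uniform error depend continuously on the nodes. -/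
lemma tendsto_affineError_minimizer [Nontrivial ι] {α : Type*} {l : Filter α}
    {y : α → ι → ℝ} {P : α → ℝ × ℝ} {p : ℝ × ℝ} (hx : Function.Injective x)
    (hy : Tendsto y l (𝓝 x))
    (hP : ∀ᶠ k in l, ∀ q, affineError (y k) T (P k) ≤ affineError (y k) T q)
    (hp : ∀ q, affineError x T p ≤ affineError x T q) : Tendsto P l (𝓝 p) := by
  obtain ⟨i, j, hij⟩ := exists_pair_ne ι
  have hyi := tendsto_pi_nhds.1 hy i
  have hyj := tendsto_pi_nhds.1 hy j
  set δ := |x i - x j| / 2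
  have hδpos : 0 < |x i - x j| := abs_pos.2 (sub_ne_zero.2 (hx.ne hij))
  have hbound : ∀ᶠ k in l, P k ∈ Metric.closedBall (0 : ℝ × ℝ)
      (4 * ‖T‖ / δ + (2 * ‖T‖ + 4 * ‖T‖ / δ * (|x i| + 1))) := by
    filter_upwards [hP, (hyi.sub hyj).abs.eventually_const_lt (half_lt_self hδpos),
      hyi.abs.eventually_lt_const (lt_add_one |x i|)] with k hk hgap hi
    have hval (m : ι) : |(P k).1 * y k m + (P k).2| ≤ 2 * ‖T‖ := by
      have h₁ := (abs_le_affineError (x := y k) (T := T) (P k) m).trans (hk 0)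
      have h₂ : affineError (y k) T 0 = ‖T‖ := by
        simp only [affineError, Prod.fst_zero, Prod.snd_zero, zero_mul, zero_add, zero_sub]
        exact norm_neg T
      have h₃ : |T m| ≤ ‖T‖ := norm_le_pi_norm T m
      rw [h₂] at h₁
      rw [abs_le] at *
      constructor <;> linarith [h₁.1, h₁.2, h₃.1, h₃.2]
    have hfst : |(P k).1| ≤ 4 * ‖T‖ / δ := by
      rw [le_div_iff₀ (half_pos hδpos)]
      calc |(P k).1| * δ ≤ |(P k).1| * |y k i - y k j| := by gcongr
        _ = |((P k).1 * y k i + (P k).2) - ((P k).1 * y k j + (P k).2)| := by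
          rw [← abs_mul]; ring_nf
        _ ≤ 2 * ‖T‖ + 2 * ‖T‖ := (abs_sub _ _).trans (add_le_add (hval i) (hval j))
        _ = 4 * ‖T‖ := by ring
    have hsnd : |(P k).2| ≤ 2 * ‖T‖ + 4 * ‖T‖ / δ * (|x i| + 1) := by
      calc |(P k).2| = |((P k).1 * y k i + (P k).2) - (P k).1 * y k i| := by ring_nf
        _ ≤ |(P k).1 * y k i + (P k).2| + |(P k).1| * |y k i| := by
          rw [← abs_mul]; exact abs_sub _ _
        _ ≤ _ := by gcongr; exact hval i
    rw [mem_closedBall_zero_iff, Prod.norm_def]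
    refine max_le ?_ ?_ <;> simp only [Real.norm_eq_abs]
    · linarith [abs_nonneg (P k).2]
    · linarith [abs_nonneg (P k).1]
  refine (isCompact_closedBall _ _).tendsto_nhds_of_unique_mapClusterPt hbound fun q _ hq => ?_
  obtain ⟨U, hU, hUq⟩ := mapClusterPt_iff_ultrafilter.1 hq
  have hcont {Q : α → ℝ × ℝ} {s : ℝ × ℝ} (hQ : Tendsto Q U (𝓝 s)) :
      Tendsto (fun k => affineError (y k) T (Q k)) U (𝓝 (affineError x T s)) :=
    Tendsto.norm <| tendsto_pi_nhds.2 fun m =>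
      ((hQ.fst_nhds.mul (tendsto_pi_nhds.1 (hy.mono_left hU) m)).add hQ.snd_nhds).sub_const _
  exact affineError_minimizer_unique hx (fun s => le_of_tendsto_of_tendsto (hcont hUq)
    (hcont tendsto_const_nhds) ((hP.filter_mono hU).mono fun k hk => hk s)) hp

end

/-- For a dataset with `n ≥ 3` and each `k ≠ 0` there is a unique minimizing
pair `(a_k, b_k)`, and the maps `k ↦ a_k`, `k ↦ b_k` and
`k ↦ (a_k·exp(k·t₁)+b_k, …, a_k·exp(k·t_n)+b_k)` are continuous on `ℝ ∖ {0}`. -/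
theorem stmt_8 (n : ℕ) (hn : 3 ≤ n) (t T : Fin n → ℝ) (ht : StrictMono t) :
    (∀ k : ℝ, k ≠ 0 → ∃! p : ℝ × ℝ, ∀ a b : ℝ,
      (⨆ i : Fin n, |p.1 * Real.exp (k * t i) + p.2 - T i|) ≤
        ⨆ i : Fin n, |a * Real.exp (k * t i) + b - T i|) ∧
    (∀ A B : ℝ → ℝ,
      (∀ k : ℝ, k ≠ 0 → ∀ a b : ℝ,
        (⨆ i : Fin n, |A k * Real.exp (k * t i) + B k - T i|) ≤
          ⨆ i : Fin n, |a * Real.exp (k * t i) + b - T i|) →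
      ContinuousOn A {k : ℝ | k ≠ 0} ∧ ContinuousOn B {k : ℝ | k ≠ 0} ∧
      ContinuousOn (fun k : ℝ => fun i : Fin n => A k * Real.exp (k * t i) + B k)
        {k : ℝ | k ≠ 0}) := by
  have : Nontrivial (Fin n) := Fin.nontrivial_iff_two_le.2 (by omega)
  have hinj (k : ℝ) (hk : k ≠ 0) : Function.Injective fun i => Real.exp (k * t i) :=
    fun i j h => ht.injective (mul_left_cancel₀ hk (Real.exp_injective h))
  have herr (k a b : ℝ) : ⨆ i, |a * Real.exp (k * t i) + b - T i| =
      affineError (fun i => Real.exp (k * t i)) T (a, b) :=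
    iSup_abs_eq_affineError (fun i => Real.exp (k * t i)) T a b
  simp only [herr]
  refine ⟨fun k hk => ?_, fun A B hAB => ?_⟩
  · obtain ⟨p, hp⟩ := exists_affineError_minimizer (fun i => Real.exp (k * t i)) T
    exact ⟨p, fun a b => hp (a, b), fun q hq =>
      affineError_minimizer_unique (hinj k hk) (fun r => hq r.1 r.2) hp⟩
  · have hP : ContinuousOn (fun k => (A k, B k)) {k : ℝ | k ≠ 0} := fun k hk =>
      tendsto_affineError_minimizer (y := fun k i => Real.exp (k * t i)) (T := T) (hinj k hk)
        ((by fun_prop : Continuous fun (k : ℝ) (i : Fin n) =>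
          Real.exp (k * t i)).continuousWithinAt)
        (eventually_mem_nhdsWithin.mono fun k' hk' r => hAB k' hk' r.1 r.2)
        (fun r => hAB k hk r.1 r.2)
    have hA := hP.fst
    have hB := hP.snd
    exact ⟨hA, hB, by fun_prop⟩
end

section
/- Let (𝔱,T) be a dataset with n ≥ 3. There exists exactly one line r(t) = a·t+b such that for some indices 1 ≤ i < j < m ≤ n and some δ ∈ {−1,1} one has T_i−r(t_i) = r(t_j)−T_j = T_m−r(t_m) = δ·max_{1≤l≤n}|T_l−r(t_l)|; moreover this line satisfies max_{1≤l≤n}|T_l−r(t_l)| < max_{1≤l≤n}|T_l−(c·t_l+d)| for every line c·t+d different from r. -/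
open Real

/-- The levelled error of the points `(x, X)`, `(y, Y)`, `(z, Z)`: the common value, up to
alternating sign, of the residuals of the line that equioscillates at these points. -/
noncomputable def levelledError (x y z X Y Z : ℝ) : ℝ :=
  ((z - y) * X - (z - x) * Y + (y - x) * Z) / (2 * (z - x))

/-- The line equioscillating at three points has residuals `h, -h, h`. -/
lemma exists_line_levelledError {x y z : ℝ} (hxy : x < y) (hyz : y < z) (X Y Z : ℝ) :
    ∃ a b : ℝ, X - (a * x + b) = levelledError x y z X Y Z ∧
      (a * y + b) - Y = levelledError x y z X Y Z ∧
      Z - (a * z + b) = levelledError x y z X Y Z := by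
  have hzx : z - x ≠ 0 := by linarith
  refine ⟨(Z - X) / (z - x), X - (Z - X) / (z - x) * x - levelledError x y z X Y Z, ?_, ?_, ?_⟩
  all_goals
    unfold levelledError
    field_simp
    ring

/-- Residuals with alternating signs and size at least `H`, not all equal to `H` in absolute
value, force a levelled error larger than `H`. -/
lemma lt_abs_levelledError {x y z X Y Z a b s H : ℝ} (hxy : x < y) (hyz : y < z)
    (hs : s = 1 ∨ s = -1)
    (hX : H ≤ s * (X - (a * x + b))) (hY : H ≤ -(s * (Y - (a * y + b))))
    (hZ : H ≤ s * (Z - (a * z + b)))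
    (hlt : H < s * (X - (a * x + b)) ∨ H < -(s * (Y - (a * y + b))) ∨
      H < s * (Z - (a * z + b))) :
    H < |levelledError x y z X Y Z| := by
  have key : H < s * levelledError x y z X Y Z := by
    have e : s * levelledError x y z X Y Z =
        ((z - y) * (s * (X - (a * x + b))) + (z - x) * (-(s * (Y - (a * y + b)))) +
          (y - x) * (s * (Z - (a * z + b)))) / (2 * (z - x)) := by
      unfold levelledError
      ring
    rw [e, lt_div_iff₀ (by linarith)]
    generalize s * (X - (a * x + b)) = u at *
    generalize -(s * (Y - (a * y + b))) = v at *
    generalize s * (Z - (a * z + b)) = w at *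
    have h1 := mul_nonneg (sub_pos.2 hyz).le (sub_nonneg.2 hX)
    have h2 := mul_nonneg (sub_pos.2 (hxy.trans hyz)).le (sub_nonneg.2 hY)
    have h3 := mul_nonneg (sub_pos.2 hxy).le (sub_nonneg.2 hZ)
    rcases hlt with h | h | h
    · nlinarith [mul_pos (sub_pos.2 hyz) (sub_pos.2 h)]
    · nlinarith [mul_pos (sub_pos.2 (hxy.trans hyz)) (sub_pos.2 h)]
    · nlinarith [mul_pos (sub_pos.2 hxy) (sub_pos.2 h)]
  refine key.trans_le ?_
  rcases hs with rfl | rfl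
  · simpa using le_abs_self _
  · simpa using neg_le_abs _

/-- A point whose residual exceeds the levelled error of a triple can be exchanged into the
triple so as to increase the levelled error. -/
lemma exists_lt_abs_levelledError {ι : Type*} [LinearOrder ι] {t T : ι → ℝ} (ht : StrictMono t)
    {a b s H : ℝ} (hs : s = 1 ∨ s = -1) (hH : 0 ≤ H) {i j m l : ι} (hij : i < j) (hjm : j < m)
    (hi : s * (T i - (a * t i + b)) = H) (hj : s * (T j - (a * t j + b)) = -H)
    (hm : s * (T m - (a * t m + b)) = H) (hl : H < |T l - (a * t l + b)|) :
    ∃ i' j' m' : ι, i' < j' ∧ j' < m' ∧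
      H < |levelledError (t i') (t j') (t m') (T i') (T j') (T m')| := by
  have hs' : -s = 1 ∨ -s = -1 := by
    rcases hs with rfl | rfl <;> simp
  have hl' : H < s * (T l - (a * t l + b)) ∨ s * (T l - (a * t l + b)) < -H := by
    rcases hs with rfl | rfl <;> rcases lt_abs.1 hl with h | h
    · left; linarith
    · right; linarith
    · right; linarith
    · left; linarith
  rcases hl' with h | h
  · rcases lt_trichotomy l j with hlj | rfl | hjl
    · exact ⟨l, j, m, hlj, hjm,
        lt_abs_levelledError (a := a) (b := b) (ht hlj) (ht hjm) hs
          (by linarith) (by linarith) (by linarith) (.inl h)⟩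
    · linarith
    · exact ⟨i, j, l, hij, hjl,
        lt_abs_levelledError (a := a) (b := b) (ht hij) (ht hjl) hs
          (by linarith) (by linarith) (by linarith) (.inr (.inr h))⟩
  · rcases lt_trichotomy l i with hli | rfl | hil
    · exact ⟨l, i, j, hli, hij,
        lt_abs_levelledError (a := a) (b := b) (ht hli) (ht hij) hs'
          (by linarith) (by linarith) (by linarith) (.inl (by linarith))⟩
    · linarith
    · rcases lt_trichotomy l m with hlm | rfl | hml
      · exact ⟨i, l, m, hil, hlm,
          lt_abs_levelledError (a := a) (b := b) (ht hil) (ht hlm) hs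
            (by linarith) (by linarith) (by linarith) (.inr (.inl (by linarith)))⟩
      · linarith
      · exact ⟨j, m, l, hjm, hml,
          lt_abs_levelledError (a := a) (b := b) (ht hjm) (ht hml) hs'
            (by linarith) (by linarith) (by linarith) (.inr (.inr (by linarith)))⟩

/-- A line that is nonnegative, nonpositive and nonnegative at three successive points
vanishes. -/
lemma line_eq_zero_of_signs {x y z a b : ℝ} (hxy : x < y) (hyz : y < z)
    (hx : 0 ≤ a * x + b) (hy : a * y + b ≤ 0) (hz : 0 ≤ a * z + b) : a = 0 ∧ b = 0 := by
  have ha : a = 0 := by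
    apply le_antisymm
    · by_contra! h
      nlinarith [mul_pos h (sub_pos.2 hxy)]
    · by_contra! h
      nlinarith [mul_pos_of_neg_of_neg h (sub_neg.2 hyz)]
  subst ha
  exact ⟨rfl, by linarith⟩

/-- A line equioscillating at three points has strictly smaller maximal error than any other
line. -/
lemma iSup_abs_residual_lt {n : ℕ} {t T : Fin n → ℝ} (ht : StrictMono t) (p : ℝ × ℝ)
    (hp : ∃ i j m : Fin n, i < j ∧ j < m ∧ ∃ δ : ℝ, (δ = 1 ∨ δ = -1) ∧
        T i - (p.1 * t i + p.2) = δ * (⨆ l : Fin n, |T l - (p.1 * t l + p.2)|) ∧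
        (p.1 * t j + p.2) - T j = δ * (⨆ l : Fin n, |T l - (p.1 * t l + p.2)|) ∧
        T m - (p.1 * t m + p.2) = δ * (⨆ l : Fin n, |T l - (p.1 * t l + p.2)|))
    (q : ℝ × ℝ) (hq : q ≠ p) :
    (⨆ l : Fin n, |T l - (p.1 * t l + p.2)|) < ⨆ l : Fin n, |T l - (q.1 * t l + q.2)| := by
  obtain ⟨i, j, m, hij, hjm, δ, hδ, hi, hj, hm⟩ := hp
  by_contra! hle
  have hb (l : Fin n) : |T l - (q.1 * t l + q.2)| ≤ ⨆ l : Fin n, |T l - (p.1 * t l + p.2)| :=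
    (le_ciSup (f := fun l : Fin n => |T l - (q.1 * t l + q.2)|)
      (Set.finite_range _).bddAbove l).trans hle
  generalize (⨆ l : Fin n, |T l - (p.1 * t l + p.2)|) = M at *
  have bi := abs_le.1 (hb i)
  have bj := abs_le.1 (hb j)
  have bm := abs_le.1 (hb m)
  apply hq
  rcases hδ with rfl | rfl
  · obtain ⟨h1, h2⟩ := line_eq_zero_of_signs (a := q.1 - p.1) (b := q.2 - p.2) (ht hij) (ht hjm)
      (by linarith) (by linarith) (by linarith)
    exact Prod.ext (by linarith) (by linarith)
  · obtain ⟨h1, h2⟩ := line_eq_zero_of_signs (a := p.1 - q.1) (b := p.2 - q.2) (ht hij) (ht hjm)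
      (by linarith) (by linarith) (by linarith)
    exact Prod.ext (by linarith) (by linarith)

/-- Some line equioscillates at three points with its maximal error. -/
lemma exists_equioscillating_line {n : ℕ} (hn : 3 ≤ n) {t : Fin n → ℝ} (T : Fin n → ℝ)
    (ht : StrictMono t) :
    ∃ p : ℝ × ℝ, ∃ i j m : Fin n, i < j ∧ j < m ∧ ∃ δ : ℝ, (δ = 1 ∨ δ = -1) ∧
        T i - (p.1 * t i + p.2) = δ * (⨆ l : Fin n, |T l - (p.1 * t l + p.2)|) ∧
        (p.1 * t j + p.2) - T j = δ * (⨆ l : Fin n, |T l - (p.1 * t l + p.2)|) ∧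
        T m - (p.1 * t m + p.2) = δ * (⨆ l : Fin n, |T l - (p.1 * t l + p.2)|) := by
  obtain ⟨⟨i, j, m⟩, hmem, hmax⟩ := Set.exists_max_image
    {x : Fin n × Fin n × Fin n | x.1 < x.2.1 ∧ x.2.1 < x.2.2}
    (fun x => |levelledError (t x.1) (t x.2.1) (t x.2.2) (T x.1) (T x.2.1) (T x.2.2)|)
    (Set.toFinite _)
    ⟨(⟨0, by omega⟩, ⟨1, by omega⟩, ⟨2, by omega⟩), by simp⟩
  obtain ⟨hij, hjm⟩ : i < j ∧ j < m := hmem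
  obtain ⟨a, b, hi, hj, hm⟩ :=
    exists_line_levelledError (ht hij) (ht hjm) (T i) (T j) (T m)
  dsimp only at hmax
  generalize levelledError (t i) (t j) (t m) (T i) (T j) (T m) = h at *
  obtain ⟨δ, hδ, hδh⟩ : ∃ δ : ℝ, (δ = 1 ∨ δ = -1) ∧ h = δ * |h| := by
    rcases abs_cases h with ⟨e, -⟩ | ⟨e, -⟩
    · exact ⟨1, .inl rfl, by rw [e]; ring⟩
    · exact ⟨-1, .inr rfl, by rw [e]; ring⟩
  have hδ' : δ * h = |h| := by
    rcases hδ with rfl | rfl <;> linarith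
  have hsup : (⨆ l : Fin n, |T l - (a * t l + b)|) = |h| := by
    have : Nonempty (Fin n) := ⟨i⟩
    apply le_antisymm
    · refine ciSup_le fun l => ?_
      by_contra! hl
      obtain ⟨i', j', m', h1, h2, h3⟩ := exists_lt_abs_levelledError ht hδ (abs_nonneg h) hij hjm
        (by rw [hi, hδ']) (by rw [← hδ', ← hj]; ring) (by rw [hm, hδ']) hl
      exact (hmax (i', j', m') ⟨h1, h2⟩).not_gt h3
    · rw [← hi]
      exact le_ciSup (f := fun l : Fin n => |T l - (a * t l + b)|)
        (Set.finite_range _).bddAbove i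
  refine ⟨(a, b), i, j, m, hij, hjm, δ, hδ, ?_⟩
  dsimp only
  rw [hsup, ← hδh]
  exact ⟨hi, hj, hm⟩

/-- Chebyshev alternation for lines: there is exactly one line `r(t)=a·t+b`
equioscillating at three indices, and this line is the unique strict minimizer of the
max-norm error among all lines. -/
theorem stmt_9 (n : ℕ) (hn : 3 ≤ n) (t T : Fin n → ℝ) (ht : StrictMono t) :
    (∃! p : ℝ × ℝ,
      ∃ i j m : Fin n, i < j ∧ j < m ∧ ∃ δ : ℝ, (δ = 1 ∨ δ = -1) ∧
        T i - (p.1 * t i + p.2) = δ * (⨆ l : Fin n, |T l - (p.1 * t l + p.2)|) ∧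
        (p.1 * t j + p.2) - T j = δ * (⨆ l : Fin n, |T l - (p.1 * t l + p.2)|) ∧
        T m - (p.1 * t m + p.2) = δ * (⨆ l : Fin n, |T l - (p.1 * t l + p.2)|)) ∧
    (∀ p : ℝ × ℝ,
      (∃ i j m : Fin n, i < j ∧ j < m ∧ ∃ δ : ℝ, (δ = 1 ∨ δ = -1) ∧
        T i - (p.1 * t i + p.2) = δ * (⨆ l : Fin n, |T l - (p.1 * t l + p.2)|) ∧
        (p.1 * t j + p.2) - T j = δ * (⨆ l : Fin n, |T l - (p.1 * t l + p.2)|) ∧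
        T m - (p.1 * t m + p.2) = δ * (⨆ l : Fin n, |T l - (p.1 * t l + p.2)|)) →
      ∀ q : ℝ × ℝ, q ≠ p →
        (⨆ l : Fin n, |T l - (p.1 * t l + p.2)|) <
          ⨆ l : Fin n, |T l - (q.1 * t l + q.2)|) := by
  refine ⟨?_, iSup_abs_residual_lt ht⟩
  obtain ⟨p, hp⟩ := exists_equioscillating_line hn T ht
  refine ⟨p, hp, fun q hq => ?_⟩
  by_contra hne
  exact lt_asymm (iSup_abs_residual_lt ht p hp q hne)
    (iSup_abs_residual_lt ht q hq p (Ne.symm hne))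
end

section
/- Let t_1 < t_2 < t_3 < t_4 be real numbers and T_1 > T_3. For k ≠ 0 let g_k(t) = a_k·exp(k·t)+b_k with a_k = (T_1−T_3)/(exp(k·t_1)−exp(k·t_3)) and b_k = T_1 − a_k·exp(k·t_1) (so that g_k(t_1)=T_1 and g_k(t_3)=T_3), and let r be the line with r(t_1)=T_1 and r(t_3)=T_3. Then: as k → ∞, g_k(t_4) → −∞ and g_k(t_2) → T_1; as k → −∞, g_k(t_4) → T_3 and g_k(t_2) → T_3; as k → 0, g_k(t_4) → r(t_4) and g_k(t_2) → r(t_2). -/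
open Real Filter Topology

theorem tendsto_exp_mul_atTop_nhds_zero {w : ℝ} (hw : w < 0) :
    Tendsto (fun k : ℝ => Real.exp (k * w)) atTop (𝓝 0) :=
  Real.tendsto_exp_atBot.comp (tendsto_id.atTop_mul_const_of_neg hw)

theorem tendsto_exp_mul_atBot_nhds_zero {w : ℝ} (hw : 0 < w) :
    Tendsto (fun k : ℝ => Real.exp (k * w)) atBot (𝓝 0) :=
  Real.tendsto_exp_atBot.comp (tendsto_id.atBot_mul_const hw)

theorem exp_mul_sub_one_div_eq (u v k : ℝ) :
    (Real.exp (k * u) - 1) / (Real.exp (k * v) - 1) =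
      (Real.exp (k * (u - v)) - Real.exp (k * -v)) / (1 - Real.exp (k * -v)) := by
  have hu : Real.exp (k * (u - v)) = Real.exp (k * u) * Real.exp (k * -v) := by
    rw [← Real.exp_add]; ring_nf
  have hv : Real.exp (k * v) * Real.exp (k * -v) = 1 := by
    rw [← Real.exp_add]; simp
  rw [← mul_div_mul_right _ _ (Real.exp_ne_zero (k * -v)), sub_mul, sub_mul, hv, hu, one_mul]

theorem tendsto_exp_mul_sub_one_div_atTop_nhds_zero {u v : ℝ} (hv : 0 < v) (huv : u < v) :
    Tendsto (fun k : ℝ => (Real.exp (k * u) - 1) / (Real.exp (k * v) - 1)) atTop (𝓝 0) := by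
  simp_rw [exp_mul_sub_one_div_eq u v]
  have h := tendsto_exp_mul_atTop_nhds_zero (neg_lt_zero.2 hv)
  simpa [Pi.div_def] using ((tendsto_exp_mul_atTop_nhds_zero (sub_neg.2 huv)).sub h).div
    (tendsto_const_nhds.sub h) (by norm_num : (1 : ℝ) - 0 ≠ 0)

theorem tendsto_exp_mul_sub_one_div_atTop_atTop {u v : ℝ} (hv : 0 < v) (huv : v < u) :
    Tendsto (fun k : ℝ => (Real.exp (k * u) - 1) / (Real.exp (k * v) - 1)) atTop atTop := by
  simp_rw [exp_mul_sub_one_div_eq u v, div_eq_mul_inv]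
  have h := tendsto_exp_mul_atTop_nhds_zero (neg_lt_zero.2 hv)
  have hnum : Tendsto (fun k : ℝ => Real.exp (k * (u - v)) - Real.exp (k * -v)) atTop atTop := by
    have hexp : Tendsto (fun k : ℝ => Real.exp (k * (u - v))) atTop atTop :=
      Real.tendsto_exp_atTop.comp (tendsto_id.atTop_mul_const (sub_pos.2 huv))
    simpa only [← sub_eq_add_neg] using hexp.atTop_add h.neg
  have hden : Tendsto (fun k : ℝ => (1 - Real.exp (k * -v))⁻¹) atTop (𝓝 1) := by
    simpa using (tendsto_const_nhds.sub h).inv₀ (by norm_num : (1 : ℝ) - 0 ≠ 0)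
  exact hnum.atTop_mul_pos one_pos hden

theorem tendsto_exp_mul_sub_one_div_atBot {u v : ℝ} (hu : 0 < u) (hv : 0 < v) :
    Tendsto (fun k : ℝ => (Real.exp (k * u) - 1) / (Real.exp (k * v) - 1)) atBot (𝓝 1) := by
  simpa [Pi.div_def] using ((tendsto_exp_mul_atBot_nhds_zero hu).sub_const 1).div
    ((tendsto_exp_mul_atBot_nhds_zero hv).sub_const 1) (by norm_num : (0 : ℝ) - 1 ≠ 0)

theorem tendsto_exp_mul_sub_one_div_self (u : ℝ) :
    Tendsto (fun k : ℝ => (Real.exp (k * u) - 1) / k) (𝓝[≠] 0) (𝓝 u) := by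
  have h : HasDerivAt (fun k : ℝ => Real.exp (k * u)) u 0 := by
    simpa using ((hasDerivAt_id (0 : ℝ)).mul_const u).exp
  simpa [div_eq_inv_mul] using h.tendsto_slope_zero

theorem tendsto_exp_mul_sub_one_div_nhds_zero (u : ℝ) {v : ℝ} (hv : v ≠ 0) :
    Tendsto (fun k : ℝ => (Real.exp (k * u) - 1) / (Real.exp (k * v) - 1))
      (𝓝[≠] 0) (𝓝 (u / v)) := by
  refine ((tendsto_exp_mul_sub_one_div_self u).div
    (tendsto_exp_mul_sub_one_div_self v) hv).congr' ?_
  filter_upwards [self_mem_nhdsWithin] with k hk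
  exact div_div_div_cancel_right₀ hk _ _

/-- The exponential interpolant in terms of the ratio of increments of the exponential. -/
theorem exp_interpolant_eq (t₁ t₃ T₁ T₃ k s : ℝ) :
    (T₁ - T₃) / (Real.exp (k * t₁) - Real.exp (k * t₃)) * Real.exp (k * s)
        + (T₁ - (T₁ - T₃) / (Real.exp (k * t₁) - Real.exp (k * t₃)) * Real.exp (k * t₁)) =
      T₁ - (T₁ - T₃) * ((Real.exp (k * (s - t₁)) - 1) / (Real.exp (k * (t₃ - t₁)) - 1)) := by
  have key (x : ℝ) :
      Real.exp (k * x) - Real.exp (k * t₁) =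
        (Real.exp (k * (x - t₁)) - 1) * Real.exp (k * t₁) := by
    rw [sub_mul, ← Real.exp_add]; ring_nf
  rw [← mul_div_mul_right (Real.exp (k * (s - t₁)) - 1) _ (Real.exp_ne_zero (k * t₁)),
    ← key, ← key,
    ← neg_sub (Real.exp (k * t₃)) (Real.exp (k * t₁)), div_neg]
  ring

/-- For `t₁ < t₂ < t₃ < t₄` and `T₁ > T₃`, let `g_k` be the exponential with
exponent `k` interpolating `(t₁,T₁)` and `(t₃,T₃)`, and `r` the line through those points.
Then `g_k(t₄) → −∞` and `g_k(t₂) → T₁` as `k → ∞`; `g_k(t₄) → T₃` and `g_k(t₂) → T₃` as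
`k → −∞`; and `g_k(t₄) → r(t₄)`, `g_k(t₂) → r(t₂)` as `k → 0`. -/
theorem stmt_11 (t₁ t₂ t₃ t₄ : ℝ) (h12 : t₁ < t₂) (h23 : t₂ < t₃) (h34 : t₃ < t₄)
    (T₁ T₃ : ℝ) (hT : T₁ > T₃)
    (g : ℝ → ℝ → ℝ)
    (hg : ∀ k : ℝ, k ≠ 0 → ∀ s : ℝ,
      g k s = ((T₁ - T₃) / (Real.exp (k * t₁) - Real.exp (k * t₃))) * Real.exp (k * s)
        + (T₁ - ((T₁ - T₃) / (Real.exp (k * t₁) - Real.exp (k * t₃))) * Real.exp (k * t₁)))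
    (c d : ℝ) (r : ℝ → ℝ) (hr : r = fun s => c * s + d)
    (hr1 : r t₁ = T₁) (hr3 : r t₃ = T₃) :
    Tendsto (fun k => g k t₄) atTop atBot ∧
    Tendsto (fun k => g k t₂) atTop (𝓝 T₁) ∧
    Tendsto (fun k => g k t₄) atBot (𝓝 T₃) ∧
    Tendsto (fun k => g k t₂) atBot (𝓝 T₃) ∧
    Tendsto (fun k => g k t₄) (𝓝[≠] (0 : ℝ)) (𝓝 (r t₄)) ∧
    Tendsto (fun k => g k t₂) (𝓝[≠] (0 : ℝ)) (𝓝 (r t₂)) := by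
  have hv : 0 < t₃ - t₁ := by linarith
  have hg' (s k : ℝ) (hk : k ≠ 0) :
      T₁ - (T₁ - T₃) * ((Real.exp (k * (s - t₁)) - 1) / (Real.exp (k * (t₃ - t₁)) - 1)) =
        g k s := by
    rw [hg k hk, exp_interpolant_eq]
  have hlim {l : Filter ℝ} (hl : ∀ᶠ k in l, k ≠ 0) (s : ℝ) {L : ℝ}
      (h : Tendsto (fun k : ℝ => (Real.exp (k * (s - t₁)) - 1) / (Real.exp (k * (t₃ - t₁)) - 1))
        l (𝓝 L)) : Tendsto (fun k => g k s) l (𝓝 (T₁ - (T₁ - T₃) * L)) :=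
    ((h.const_mul _).const_sub _).congr' (hl.mono (hg' s))
  have hr' (s : ℝ) : T₁ - (T₁ - T₃) * ((s - t₁) / (t₃ - t₁)) = r s := by
    subst hr
    have hne := hv.ne'
    simp only at hr1 hr3 ⊢
    rw [← hr1, ← hr3]
    field_simp
    ring
  have hbot : ∀ᶠ k : ℝ in atBot, k ≠ 0 := eventually_ne_atBot 0
  have htop : ∀ᶠ k : ℝ in atTop, k ≠ 0 := eventually_ne_atTop 0
  have hzero : ∀ᶠ k : ℝ in 𝓝[≠] 0, k ≠ 0 := self_mem_nhdsWithin
  refine ⟨?_, ?_, ?_, ?_, ?_, ?_⟩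
  · have h := (tendsto_exp_mul_sub_one_div_atTop_atTop hv
      (by linarith : t₃ - t₁ < t₄ - t₁)).const_mul_atTop (sub_pos.2 hT)
    refine Tendsto.congr' (htop.mono (hg' t₄)) ?_
    simpa only [sub_eq_add_neg, Function.comp_apply] using
      tendsto_atBot_add_const_left _ T₁ (tendsto_neg_atTop_atBot.comp h)
  · simpa using hlim htop t₂ (tendsto_exp_mul_sub_one_div_atTop_nhds_zero hv (by linarith))
  · simpa using hlim hbot t₄ (tendsto_exp_mul_sub_one_div_atBot (by linarith) hv)
  · simpa using hlim hbot t₂ (tendsto_exp_mul_sub_one_div_atBot (by linarith) hv)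
  · simpa only [hr'] using
      hlim hzero t₄ (tendsto_exp_mul_sub_one_div_nhds_zero _ hv.ne')
  · simpa only [hr'] using
      hlim hzero t₂ (tendsto_exp_mul_sub_one_div_nhds_zero _ hv.ne')
end

section
/- Let t_0 < t_1 < t_2 < t_3 < t_4 be real numbers and T_1 > T_3. For k ≠ 0 let g_k(t) = a_k·exp(k·t)+b_k be the unique exponential with exponent k satisfying g_k(t_1)=T_1 and g_k(t_3)=T_3, and let g_0 be the unique line with g_0(t_1)=T_1 and g_0(t_3)=T_3. Then: (1) the map φ_0: ℝ → (T_1,∞), k ↦ g_k(t_0), is a strictly decreasing homeomorphism onto (T_1,∞); (2) the map φ_2: ℝ → (T_3,T_1), k ↦ g_k(t_2), is a strictly increasing homeomorphism onto (T_3,T_1); (3) the map φ_4: ℝ → (−∞,T_3), k ↦ g_k(t_4), is a strictly decreasing homeomorphism onto (−∞,T_3). -/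
open Real Filter Topology

lemma mul_dslope_exp_zero (x : ℝ) : x * dslope Real.exp 0 x = Real.exp x - 1 := by
  simpa using sub_smul_dslope Real.exp 0 x

lemma dslope_exp_zero_zero : dslope Real.exp 0 0 = 1 := by
  simp [dslope_same]

lemma dslope_exp_zero_of_ne {x : ℝ} (hx : x ≠ 0) :
    dslope Real.exp 0 x = (Real.exp x - 1) / x := by
  rw [eq_div_iff hx, mul_comm, mul_dslope_exp_zero]

lemma dslope_exp_zero_pos (x : ℝ) : 0 < dslope Real.exp 0 x := by
  rcases lt_trichotomy x 0 with hx | rfl | hx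
  · rw [dslope_exp_zero_of_ne hx.ne]
    exact div_pos_of_neg_of_neg (by linarith [Real.exp_lt_one_iff.2 hx]) hx
  · simp
  · rw [dslope_exp_zero_of_ne hx.ne']
    exact div_pos (by linarith [Real.add_one_lt_exp hx.ne']) hx

lemma continuous_dslope_exp_zero : Continuous (dslope Real.exp 0) := by
  rw [← continuousOn_univ, continuousOn_dslope univ_mem]
  exact ⟨Real.continuous_exp.continuousOn, Real.differentiableAt_exp⟩

lemma strictMono_dslope_exp_zero : StrictMono (dslope Real.exp 0) := by
  intro x y hxy
  rcases eq_or_ne x 0 with rfl | hx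
  · rw [dslope_exp_zero_zero, dslope_exp_zero_of_ne hxy.ne', lt_div_iff₀ hxy]
    linarith [Real.add_one_lt_exp hxy.ne']
  rcases eq_or_ne y 0 with rfl | hy
  · rw [dslope_exp_zero_zero, dslope_exp_zero_of_ne hx, div_lt_iff_of_neg hxy]
    linarith [Real.add_one_lt_exp hx]
  · rw [dslope_exp_zero_of_ne hx, dslope_exp_zero_of_ne hy]
    simpa using strictConvexOn_exp.secant_strict_mono (Set.mem_univ 0) (Set.mem_univ x)
      (Set.mem_univ y) hx hy hxy

lemma tendsto_dslope_exp_zero_atTop : Tendsto (dslope Real.exp 0) atTop atTop := by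
  have h : Tendsto (fun x : ℝ => x / 2) atTop atTop := tendsto_id.atTop_div_const two_pos
  refine tendsto_atTop_mono' _ ?_ h
  filter_upwards [eventually_gt_atTop 0] with x hx
  rw [dslope_exp_zero_of_ne hx.ne', le_div_iff₀ hx]
  nlinarith [Real.quadratic_le_exp_of_nonneg hx.le]

lemma tendsto_dslope_exp_zero_atBot : Tendsto (dslope Real.exp 0) atBot (𝓝 0) := by
  have h : Tendsto (fun x : ℝ => -x⁻¹) atBot (𝓝 0) := by
    simpa using (tendsto_inv_atBot_zero (𝕜 := ℝ)).neg
  refine tendsto_of_tendsto_of_tendsto_of_le_of_le' tendsto_const_nhds h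
    (Eventually.of_forall fun x => (dslope_exp_zero_pos x).le) ?_
  filter_upwards [eventually_lt_atBot 0] with x hx
  rw [dslope_exp_zero_of_ne hx.ne, div_le_iff_of_neg hx]
  have : x⁻¹ * x = 1 := inv_mul_cancel₀ hx.ne
  linarith [Real.exp_pos x]

/-- The ratio of the integrals of `s ↦ exp (k * s)` over two adjacent intervals of lengths
`p` and `q`. -/
noncomputable def expRatio (p q k : ℝ) : ℝ :=
  (p * dslope Real.exp 0 (-(k * p))) / (q * dslope Real.exp 0 (k * q))

section expRatio

variable {p q : ℝ}

lemma expRatio_pos (hp : 0 < p) (hq : 0 < q) (k : ℝ) : 0 < expRatio p q k :=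
  div_pos (mul_pos hp (dslope_exp_zero_pos _)) (mul_pos hq (dslope_exp_zero_pos _))

lemma expRatio_neg (p q k : ℝ) : expRatio p q (-k) = (expRatio q p k)⁻¹ := by
  simp [expRatio]

lemma strictAnti_expRatio (hp : 0 < p) (hq : 0 < q) : StrictAnti (expRatio p q) := by
  intro k l hkl
  have h₁ : dslope Real.exp 0 (-(l * p)) < dslope Real.exp 0 (-(k * p)) :=
    strictMono_dslope_exp_zero (by nlinarith)
  have h₂ : dslope Real.exp 0 (k * q) < dslope Real.exp 0 (l * q) :=
    strictMono_dslope_exp_zero (by nlinarith)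
  have h₃ := dslope_exp_zero_pos (k * q)
  have h₄ := dslope_exp_zero_pos (-(k * p))
  unfold expRatio
  gcongr

lemma continuous_expRatio (hq : 0 < q) : Continuous (expRatio p q) := by
  have h := continuous_dslope_exp_zero
  refine Continuous.div (by fun_prop) (by fun_prop) fun k => ?_
  exact (mul_pos hq (dslope_exp_zero_pos _)).ne'

lemma tendsto_expRatio_atTop (hp : 0 < p) (hq : 0 < q) :
    Tendsto (expRatio p q) atTop (𝓝 0) := by
  have hp' : Tendsto (fun k : ℝ => -(k * p)) atTop atBot :=
    tendsto_neg_atTop_atBot.comp (tendsto_id.atTop_mul_const hp)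
  have hq' : Tendsto (fun k : ℝ => k * q) atTop atTop := tendsto_id.atTop_mul_const hq
  exact ((tendsto_dslope_exp_zero_atBot.comp hp').const_mul p).div_atTop
    ((tendsto_dslope_exp_zero_atTop.comp hq').const_mul_atTop hq)

lemma exists_expRatio_eq (hp : 0 < p) (hq : 0 < q) {y : ℝ} (hy : 0 < y) :
    ∃ k, expRatio p q k = y := by
  obtain ⟨k, hk⟩ := ((tendsto_expRatio_atTop hp hq).eventually_lt_const hy).exists
  obtain ⟨l, hl⟩ :=
    ((tendsto_expRatio_atTop hq hp).eventually_lt_const (inv_pos.mpr hy)).exists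
  refine mem_range_of_exists_le_of_exists_ge (continuous_expRatio hq) ⟨k, hk.le⟩ ⟨-l, ?_⟩
  rw [expRatio_neg]
  exact (le_inv_comm₀ hy (expRatio_pos hq hp l)).mpr hl.le

end expRatio

lemma StrictMono.exists_homeomorph {s : Set ℝ} [s.OrdConnected] {f : ℝ → ℝ}
    (hf : StrictMono f) (hs : Set.range f = s) : ∃ e : ℝ ≃ₜ s, ∀ k, (e k : ℝ) = f k := by
  subst hs
  exact ⟨(hf.orderIso f).toHomeomorph, fun _ => rfl⟩

lemma StrictAnti.exists_homeomorph {s : Set ℝ} [s.OrdConnected] {f : ℝ → ℝ}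
    (hf : StrictAnti f) (hs : Set.range f = s) : ∃ e : ℝ ≃ₜ s, ∀ k, (e k : ℝ) = f k := by
  have hf' : StrictMono fun k => f (-k) := fun k l hkl => hf (neg_lt_neg hkl)
  obtain ⟨e, he⟩ := hf'.exists_homeomorph ((neg_surjective.range_comp f).trans hs)
  exact ⟨(Homeomorph.neg ℝ).trans e, fun k => by simp [he]⟩

lemma sub_eq_expRatio_mul_sub {f : ℝ → ℝ} {k A : ℝ}
    (hf : ∀ u v, f u - f v = A * Real.exp (k * v) * ((u - v) * dslope Real.exp 0 (k * (u - v))))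
    {a b c : ℝ} (hbc : b < c) :
    f a - f b = expRatio (b - a) (c - b) k * (f b - f c) := by
  have h₁ := hf a b
  have h₂ := hf c b
  rw [show k * (a - b) = -(k * (b - a)) by ring] at h₁
  have h₃ := dslope_exp_zero_pos (k * (c - b))
  have h₄ : c - b ≠ 0 := (sub_pos.mpr hbc).ne'
  rw [← neg_sub (f c), h₁, h₂, expRatio]
  field_simp
  ring

lemma exp_affine_sub (k a b u v : ℝ) :
    (a * Real.exp (k * u) + b) - (a * Real.exp (k * v) + b) =
      a * k * Real.exp (k * v) * ((u - v) * dslope Real.exp 0 (k * (u - v))) := by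
  have h := mul_dslope_exp_zero (k * (u - v))
  have h' : Real.exp (k * u) = Real.exp (k * v) * Real.exp (k * (u - v)) := by
    rw [← Real.exp_add]; ring_nf
  rw [h']
  linear_combination (-a * Real.exp (k * v)) * h

/-- For `t₀ < t₁ < t₂ < t₃ < t₄` and `T₁ > T₃`, let `g_k` (for `k ≠ 0`) be
the unique exponential with exponent `k` interpolating `(t₁,T₁)`, `(t₃,T₃)`, and `g_0` the
line through those points. Then `k ↦ g_k(t₀)` is a strictly decreasing homeomorphism of `ℝ`
onto `(T₁,∞)`, `k ↦ g_k(t₂)` is a strictly increasing homeomorphism onto `(T₃,T₁)`, and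
`k ↦ g_k(t₄)` is a strictly decreasing homeomorphism onto `(−∞,T₃)`. -/
theorem stmt_12 (t₀ t₁ t₂ t₃ t₄ : ℝ)
    (h01 : t₀ < t₁) (h12 : t₁ < t₂) (h23 : t₂ < t₃) (h34 : t₃ < t₄)
    (T₁ T₃ : ℝ) (hT : T₁ > T₃)
    (g : ℝ → ℝ → ℝ)
    (hgexp : ∀ k : ℝ, k ≠ 0 → ∃ a b : ℝ, g k = fun s => a * Real.exp (k * s) + b)
    (hgline : ∃ c d : ℝ, g 0 = fun s => c * s + d)
    (hinterp : ∀ k : ℝ, g k t₁ = T₁ ∧ g k t₃ = T₃) :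
    (StrictAnti (fun k : ℝ => g k t₀) ∧
      ∃ e : ℝ ≃ₜ Set.Ioi T₁, ∀ k : ℝ, (e k : ℝ) = g k t₀) ∧
    (StrictMono (fun k : ℝ => g k t₂) ∧
      ∃ e : ℝ ≃ₜ Set.Ioo T₃ T₁, ∀ k : ℝ, (e k : ℝ) = g k t₂) ∧
    (StrictAnti (fun k : ℝ => g k t₄) ∧
      ∃ e : ℝ ≃ₜ Set.Iio T₃, ∀ k : ℝ, (e k : ℝ) = g k t₄) := by
  have key : ∀ k a b c : ℝ, b < c →
      g k a - g k b = expRatio (b - a) (c - b) k * (g k b - g k c) := by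
    intro k a b c hbc
    rcases eq_or_ne k 0 with rfl | hk
    · obtain ⟨m, d, hg⟩ := hgline
      refine sub_eq_expRatio_mul_sub (A := m) (fun u v => ?_) hbc
      simp only [hg, zero_mul, Real.exp_zero, dslope_exp_zero_zero]
      ring
    · obtain ⟨m, d, hg⟩ := hgexp k hk
      refine sub_eq_expRatio_mul_sub (A := m * k) (fun u v => ?_) hbc
      simpa only [hg] using exp_affine_sub k m d u v
  have hT' : 0 < T₁ - T₃ := sub_pos.mpr hT
  have p01 := sub_pos.mpr h01
  have p12 := sub_pos.mpr h12
  have p23 := sub_pos.mpr h23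
  have p13 := sub_pos.mpr (h12.trans h23)
  have p34 := sub_pos.mpr h34
  have e0 : ∀ k, g k t₀ = T₁ + expRatio (t₁ - t₀) (t₃ - t₁) k * (T₁ - T₃) := fun k => by
    have h := key k t₀ t₁ t₃ (h12.trans h23)
    rw [(hinterp k).1, (hinterp k).2] at h
    linarith
  have e2 : ∀ k, g k t₂ = T₃ + (T₁ - T₃) / (1 + expRatio (t₂ - t₁) (t₃ - t₂) k) := fun k => by
    have h := key k t₁ t₂ t₃ h23
    have hQ := expRatio_pos p12 p23 k
    rw [(hinterp k).1, (hinterp k).2] at h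
    field_simp
    linarith
  have e4 : ∀ k, g k t₄ = T₃ - (T₁ - T₃) / expRatio (t₃ - t₁) (t₄ - t₃) k := fun k => by
    have h := key k t₁ t₃ t₄ h34
    have hQ := expRatio_pos p13 p34 k
    rw [(hinterp k).1, (hinterp k).2] at h
    field_simp
    linarith
  simp only [e0, e2, e4]
  have m0 : StrictAnti fun k => T₁ + expRatio (t₁ - t₀) (t₃ - t₁) k * (T₁ - T₃) := by
    intro k l hkl
    have := strictAnti_expRatio p01 p13 hkl
    dsimp only
    gcongr
  have m2 : StrictMono fun k => T₃ + (T₁ - T₃) / (1 + expRatio (t₂ - t₁) (t₃ - t₂) k) := by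
    intro k l hkl
    have := strictAnti_expRatio p12 p23 hkl
    have hl := expRatio_pos p12 p23 l
    dsimp only
    gcongr
  have m4 : StrictAnti fun k => T₃ - (T₁ - T₃) / expRatio (t₃ - t₁) (t₄ - t₃) k := by
    intro k l hkl
    have := strictAnti_expRatio p13 p34 hkl
    have hl := expRatio_pos p13 p34 l
    dsimp only
    gcongr
  refine ⟨⟨m0, m0.exists_homeomorph ?_⟩, ⟨m2, m2.exists_homeomorph ?_⟩,
    ⟨m4, m4.exists_homeomorph ?_⟩⟩
  · refine Set.Subset.antisymm (Set.range_subset_iff.mpr fun k => ?_) fun y hy => ?_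
    · have := mul_pos (expRatio_pos p01 p13 k) hT'
      simpa using this
    · obtain ⟨k, hk⟩ := exists_expRatio_eq p01 p13 (div_pos (sub_pos.mpr hy) hT')
      refine ⟨k, ?_⟩
      simp only [hk]
      field_simp
      ring
  · refine Set.Subset.antisymm (Set.range_subset_iff.mpr fun k => ?_) fun y hy => ?_
    · have hQ := expRatio_pos p12 p23 k
      have h₁ : 0 < (T₁ - T₃) / (1 + expRatio (t₂ - t₁) (t₃ - t₂) k) := by positivity
      have h₂ := div_lt_self hT' (lt_add_of_pos_right 1 hQ)
      exact ⟨by linarith, by linarith⟩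
    · have h₃ := sub_pos.mpr hy.1
      obtain ⟨k, hk⟩ := exists_expRatio_eq p12 p23 (div_pos (sub_pos.mpr hy.2) h₃)
      refine ⟨k, ?_⟩
      have h : 1 + (T₁ - y) / (y - T₃) = (T₁ - T₃) / (y - T₃) := by
        field_simp
        ring
      simp only [hk, h]
      rw [div_div_cancel₀ hT'.ne']
      ring
  · refine Set.Subset.antisymm (Set.range_subset_iff.mpr fun k => ?_) fun y hy => ?_
    · have := div_pos hT' (expRatio_pos p13 p34 k)
      simpa using this
    · obtain ⟨k, hk⟩ := exists_expRatio_eq p13 p34 (div_pos hT' (sub_pos.mpr hy))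
      refine ⟨k, ?_⟩
      simp only [hk]
      rw [div_div_cancel₀ hT'.ne']
      ring
end

section
/- Let (𝔱,T) be a dataset with n = 4. There exists an exponential f(t) = a·exp(k·t)+b with a > 0 and k < 0 satisfying E(f) < E(g) for every exponential g ≠ f if and only if (𝔱,T) is admissible and condition ♠ does not hold. -/
open Real

/-- Max-norm error of the line `s ↦ a·s+b` on the dataset `(t, T)`. -/
noncomputable def lineErr {n : ℕ} (t T : Fin n → ℝ) (a b : ℝ) : ℝ :=
  ⨆ l : Fin n, |T l - (a * t l + b)|

/-- The dataset `(t, T)` is admissible: the best line `r(t)=a·t+b` has `a < 0`, and there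
are indices `i < j < m` where `T i − r(t i) = r(t j) − T j = T m − r(t m) = R` (the max
error), with `−R ≤ r(t l) − T l < R` for `l < i` and `l > m`, and `−R ≤ T l − r(t l) < R`
for `i < l < m`. -/
def Admissible {n : ℕ} (t T : Fin n → ℝ) : Prop :=
  ∃ a b : ℝ, (∀ c d : ℝ, lineErr t T a b ≤ lineErr t T c d) ∧ a < 0 ∧
    ∃ i j m : Fin n, i < j ∧ j < m ∧
      T i - (a * t i + b) = lineErr t T a b ∧
      (a * t j + b) - T j = lineErr t T a b ∧
      T m - (a * t m + b) = lineErr t T a b ∧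
      (∀ l : Fin n, (l < i ∨ m < l) →
        -(lineErr t T a b) ≤ (a * t l + b) - T l ∧ (a * t l + b) - T l < lineErr t T a b) ∧
      (∀ l : Fin n, i < l → l < m →
        -(lineErr t T a b) ≤ T l - (a * t l + b) ∧ T l - (a * t l + b) < lineErr t T a b)

/-- Condition ♠: `T 0` is the overall maximum and there are indices `0 < i < j` with
`T i` the overall minimum and `T j` the maximum of `T` over the indices `≥ 1`. -/
def Spade {n : ℕ} (hn : 0 < n) (T : Fin n → ℝ) : Prop :=
  (∀ l : Fin n, T l ≤ T ⟨0, hn⟩) ∧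
  ∃ i j : Fin n, 0 < (i : ℕ) ∧ i < j ∧
    (∀ l : Fin n, T i ≤ T l) ∧ (∀ l : Fin n, 0 < (l : ℕ) → T l ≤ T j)

lemma strictConvexOn_rpow_add_linear {A B C p : ℝ} (h : 0 < A * (p * (p - 1))) :
    StrictConvexOn ℝ (Set.Ioi 0) (fun u : ℝ => A * u ^ p + B * u + C) := by
  have hd : ∀ u : ℝ, 0 < u →
      HasDerivAt (fun u : ℝ => A * u ^ p + B * u + C) (A * (p * u ^ (p - 1)) + B) u := by
    intro u hu
    have h1 := (Real.hasDerivAt_rpow_const (x := u) (p := p) (Or.inl hu.ne')).const_mul A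
    simpa using (h1.add ((hasDerivAt_id u).const_mul B)).add_const C
  refine StrictMonoOn.strictConvexOn_of_deriv (convex_Ioi 0)
    (fun u hu => (hd u hu).continuousAt.continuousWithinAt) ?_
  rw [interior_Ioi]
  intro u hu v hv huv
  rw [(hd u hu).deriv, (hd v hv).deriv]
  have hu0 : 0 < u := hu
  rcases lt_trichotomy p 1 with hp | hp | hp
  · have h2 := Real.rpow_lt_rpow_of_neg hu0 huv (sub_neg.2 hp)
    have h3 : A * p < 0 := by nlinarith
    nlinarith
  · simp [hp] at h
  · have h2 := Real.rpow_lt_rpow hu0.le huv (sub_pos.2 hp)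
    have h3 : 0 < A * p := by nlinarith
    nlinarith

/-- In the variable `u = exp (k * s)`, a combination of two exponentials is strictly convex;
this is the three-slopes inequality with denominators cleared. -/
lemma exp_sum_three_slopes {A B C k l x y z : ℝ} (hk : k < 0) (h : 0 < A * (l * (l - k)))
    (hxy : x < y) (hyz : y < z) (D : ℝ → ℝ)
    (hD : ∀ s, D s = A * exp (l * s) + B * exp (k * s) + C) :
    (D y - D z) * (exp (k * x) - exp (k * y)) < (D x - D y) * (exp (k * y) - exp (k * z)) := by
  have hk0 : k ≠ 0 := hk.ne
  have hp : 0 < A * (l / k * (l / k - 1)) := by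
    have : A * (l / k * (l / k - 1)) = A * (l * (l - k)) / k ^ 2 := by
      field_simp
    rw [this]
    exact div_pos h (by positivity)
  have hc := strictConvexOn_rpow_add_linear (B := B) (C := C) hp
  have hE : ∀ s, D s = (fun u : ℝ => A * u ^ (l / k) + B * u + C) (exp (k * s)) := by
    intro s
    simp only [hD, ← Real.exp_mul]
    congr 4
    field_simp
  have h1 : exp (k * y) < exp (k * x) := Real.exp_lt_exp.2 (by nlinarith)
  have h2 : exp (k * z) < exp (k * y) := Real.exp_lt_exp.2 (by nlinarith)
  have h3 := hc.slope_strict_mono_adjacent (Real.exp_pos (k * z)) (Real.exp_pos (k * x)) h2 h1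
  simp only [hE]
  rw [div_lt_div_iff₀ (by linarith) (by linarith)] at h3
  exact h3

/-- An exponential sum cannot weakly alternate in sign at four points unless it vanishes. -/
lemma exp_sum_eq_zero_of_alternating_s13 {A B C k l t₀ t₁ t₂ t₃ : ℝ} (hk : k < 0) (hl : l ≠ 0)
    (h01 : t₀ < t₁) (h12 : t₁ < t₂) (h23 : t₂ < t₃) (D : ℝ → ℝ)
    (hD : ∀ s, D s = A * exp (l * s) + B * exp (k * s) + C)
    (d0 : 0 ≤ D t₀) (d1 : D t₁ ≤ 0) (d2 : 0 ≤ D t₂) (d3 : D t₃ ≤ 0) (s : ℝ) : D s = 0 := by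
  have e01 : exp (k * t₁) < exp (k * t₀) := Real.exp_lt_exp.2 (by nlinarith)
  have e12 : exp (k * t₂) < exp (k * t₁) := Real.exp_lt_exp.2 (by nlinarith)
  have e23 : exp (k * t₃) < exp (k * t₂) := Real.exp_lt_exp.2 (by nlinarith)
  rcases lt_trichotomy (A * (l * (l - k))) 0 with h | h | h
  · have := exp_sum_three_slopes (A := -A) (B := -B) (C := -C) hk (by linarith) h01 h12
      (fun s => - D s) (fun s => by simp only [hD]; ring)
    nlinarith
  · have : ∃ B', ∀ s, D s = B' * exp (k * s) + C := by
      rcases mul_eq_zero.1 h with hA | hA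
      · exact ⟨B, fun s => by rw [hD, hA]; ring⟩
      · have : l = k := by
          rcases mul_eq_zero.1 hA with h' | h'
          · exact absurd h' hl
          · linarith
        exact ⟨A + B, fun s => by rw [hD, this]; ring⟩
    obtain ⟨B', hB⟩ := this
    have hB0 : B' = 0 := by
      have a1 : 0 ≤ B' * (exp (k * t₀) - exp (k * t₁)) := by linarith [hB t₀, hB t₁]
      have a2 : B' * (exp (k * t₁) - exp (k * t₂)) ≤ 0 := by linarith [hB t₁, hB t₂]
      exact le_antisymm (by nlinarith) (by nlinarith)
    have := hB t₀
    have := hB t₁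
    have := hB s
    simp only [hB0, zero_mul] at *
    linarith
  · have := exp_sum_three_slopes hk h h12 h23 D hD
    nlinarith

/-- Sign of an exponential sum with two prescribed zeros. -/
lemma exp_sum_sign {A B C k l z₁ z₂ x : ℝ} (hk : k < 0) (h : 0 < A * (l * (l - k)))
    (hz : z₁ < z₂) (D : ℝ → ℝ) (hD : ∀ s, D s = A * exp (l * s) + B * exp (k * s) + C)
    (d1 : D z₁ = 0) (d2 : D z₂ = 0) (q : ℝ) (hx : 0 < q * ((x - z₁) * (x - z₂))) :
    0 < q * D x := by
  have hmono : ∀ {x y : ℝ}, x < y → 0 < exp (k * x) - exp (k * y) := fun {x y} hxy =>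
    sub_pos.2 (Real.exp_lt_exp.2 (by nlinarith))
  rcases lt_trichotomy x z₁ with h1 | h1 | h1
  · have := exp_sum_three_slopes hk h h1 hz D hD
    rw [d1, d2] at this
    have hp : 0 < D x := by nlinarith [hmono hz]
    have : 0 < (x - z₁) * (x - z₂) := by nlinarith
    exact mul_pos (pos_of_mul_pos_left hx this.le) hp
  · simp [h1] at hx
  · rcases lt_trichotomy x z₂ with h2 | h2 | h2
    · have := exp_sum_three_slopes hk h h1 h2 D hD
      rw [d1, d2] at this
      have hp : D x < 0 := by nlinarith [hmono h1, hmono h2]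
      have : (x - z₁) * (x - z₂) < 0 := by nlinarith
      have : q < 0 := by nlinarith
      exact mul_pos_of_neg_of_neg this hp
    · simp [h2] at hx
    · have := exp_sum_three_slopes hk h hz h2 D hD
      rw [d1, d2] at this
      have hp : 0 < D x := by nlinarith [hmono hz]
      have : 0 < (x - z₁) * (x - z₂) := by nlinarith
      exact mul_pos (pos_of_mul_pos_left hx this.le) hp

lemma approxErr_lt {n : ℕ} [NeZero n] {t T : Fin n → ℝ} {f : ℝ → ℝ} {E : ℝ}
    (h : ∀ i, |f (t i) - T i| < E) : approxErr t T f < E := by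
  obtain ⟨i, hi⟩ := exists_eq_ciSup_of_finite (f := fun i => |f (t i) - T i|)
  rw [approxErr, ← hi]
  exact h i

lemma abs_sub_le_lineErr {n : ℕ} (t T : Fin n → ℝ) (c d : ℝ) (i : Fin n) :
    |T i - (c * t i + d)| ≤ lineErr t T c d :=
  le_ciSup (f := fun i => |T i - (c * t i + d)|) (Set.finite_range _).bddAbove i

/-- An exponential whose residuals alternate at all four points is the strict best one. -/
lemma approxErr_lt_of_alternating {t T : Fin 4 → ℝ} (ht : StrictMono t) {a k b r : ℝ}
    (hk : k < 0) (h0 : T 0 - (a * exp (k * t 0) + b) = r)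
    (h1 : T 1 - (a * exp (k * t 1) + b) = -r) (h2 : T 2 - (a * exp (k * t 2) + b) = r)
    (h3 : T 3 - (a * exp (k * t 3) + b) = -r) {g : ℝ → ℝ} (hg : IsExp g)
    (hne : g ≠ fun s => a * exp (k * s) + b) :
    approxErr t T (fun s => a * exp (k * s) + b) < approxErr t T g := by
  by_contra! hle
  apply hne
  have hf : approxErr t T (fun s => a * exp (k * s) + b) ≤ |r| := by
    refine ciSup_le fun i => ?_
    rw [abs_sub_comm]
    fin_cases i <;> simp [h0, h1, h2, h3]
  have hE : ∀ i, |g (t i) - T i| ≤ |r| := fun i =>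
    (abs_sub_le_approxErr t T g i).trans (hle.trans hf)
  obtain ⟨A, B, l, hl, rfl⟩ := hg
  have t01 : t 0 < t 1 := ht (by decide)
  have t12 : t 1 < t 2 := ht (by decide)
  have t23 : t 2 < t 3 := ht (by decide)
  have g0 := abs_le.1 (hE 0)
  have g1 := abs_le.1 (hE 1)
  have g2 := abs_le.1 (hE 2)
  have g3 := abs_le.1 (hE 3)
  ext s
  rcases le_total 0 r with hr | hr
  · rw [abs_of_nonneg hr] at *
    have := exp_sum_eq_zero_of_alternating_s13 (A := A) (B := -a) (C := B - b) hk hl t01 t12 t23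
      (fun s => A * exp (l * s) + B - (a * exp (k * s) + b)) (fun s => by ring)
      (by linarith) (by linarith) (by linarith) (by linarith) s
    linarith
  · rw [abs_of_nonpos hr] at *
    have := exp_sum_eq_zero_of_alternating_s13 (A := -A) (B := a) (C := b - B) hk hl t01 t12 t23
      (fun s => a * exp (k * s) + b - (A * exp (l * s) + B)) (fun s => by ring)
      (by linarith) (by linarith) (by linarith) (by linarith) s
    linarith

/-- Unless the values `c` alternate with full amplitude `E`, the signs of the extremal ones
are matched by a quadratic polynomial with two real roots. -/
lemma exists_quadratic_sign {t c : Fin 4 → ℝ} (ht : StrictMono t) {E : ℝ} (hE : 0 < E)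
    (h : ¬ (c 1 = -c 0 ∧ c 2 = c 0 ∧ c 3 = -c 0)) :
    ∃ s z₁ z₂ : ℝ, s ≠ 0 ∧ z₁ < z₂ ∧
      ∀ i, |c i| = E → 0 < s * c i * ((t i - z₁) * (t i - z₂)) := by
  have t01 : t 0 < t 1 := ht (by decide)
  have t12 : t 1 < t 2 := ht (by decide)
  have t23 : t 2 < t 3 := ht (by decide)
  obtain ⟨σ, hσ, hcσ, hadj⟩ : ∃ σ : Fin 4 → ℝ, (∀ i, σ i = 1 ∨ σ i = -1) ∧
      (∀ i, |c i| = E → 0 < c i * σ i) ∧ (σ 0 = σ 1 ∨ σ 1 = σ 2 ∨ σ 2 = σ 3) := by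
    have single : ∀ i, ∃ τ : ℝ, (τ = 1 ∨ τ = -1) ∧ (|c i| = E → 0 < c i * τ) := by
      intro i
      rcases le_total 0 (c i) with hi | hi
      · exact ⟨1, Or.inl rfl, fun h' => by rw [abs_of_nonneg hi] at h'; linarith⟩
      · exact ⟨-1, Or.inr rfl, fun h' => by rw [abs_of_nonpos hi] at h'; linarith⟩
    have pair : ∀ i j, ¬ (c j = -c i ∧ |c i| = E) → ∃ τ : ℝ, (τ = 1 ∨ τ = -1) ∧
        (|c i| = E → 0 < c i * τ) ∧ (|c j| = E → 0 < c j * τ) := by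
      intro i j hij
      by_cases hi : |c i| = E
      · obtain ⟨τ, hτ, hiτ⟩ := single i
        refine ⟨τ, hτ, hiτ, fun hj => ?_⟩
        rcases abs_eq_abs.1 (hj.trans hi.symm) with h' | h'
        · rw [h']
          exact hiτ hi
        · exact absurd ⟨h', hi⟩ hij
      · obtain ⟨τ, hτ, hjτ⟩ := single j
        exact ⟨τ, hτ, fun h' => absurd h' hi, hjτ⟩
    obtain ⟨τ₀, a0, b0⟩ := single 0
    obtain ⟨τ₁, a1, b1⟩ := single 1
    obtain ⟨τ₂, a2, b2⟩ := single 2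
    obtain ⟨τ₃, a3, b3⟩ := single 3
    by_cases p01 : c 1 = -c 0 ∧ |c 0| = E
    · by_cases p12 : c 2 = -c 1 ∧ |c 1| = E
      · have p23 : ¬ (c 3 = -c 2 ∧ |c 2| = E) := fun p23 =>
          h ⟨p01.1, by rw [p12.1, p01.1, neg_neg], by rw [p23.1, p12.1, p01.1, neg_neg]⟩
        obtain ⟨τ, a4, b4, b5⟩ := pair 2 3 p23
        exact ⟨![τ₀, τ₁, τ, τ], by simp [Fin.forall_fin_succ, *], by
          simpa [Fin.forall_fin_succ] using ⟨b0, b1, b4, b5⟩, by simp⟩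
      · obtain ⟨τ, a4, b4, b5⟩ := pair 1 2 p12
        exact ⟨![τ₀, τ, τ, τ₃], by simp [Fin.forall_fin_succ, *], by
          simpa [Fin.forall_fin_succ] using ⟨b0, b4, b5, b3⟩, by simp⟩
    · obtain ⟨τ, a4, b4, b5⟩ := pair 0 1 p01
      exact ⟨![τ, τ, τ₂, τ₃], by simp [Fin.forall_fin_succ, *], by
        simpa [Fin.forall_fin_succ] using ⟨b4, b5, b2, b3⟩, by simp⟩
  have quad : ∃ z₁ z₂ : ℝ, z₁ < z₂ ∧ ∀ i, 0 < σ 0 * σ i * ((t i - z₁) * (t i - z₂)) := by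
    have h00 : σ 0 * σ 0 = 1 := by rcases hσ 0 with h | h <;> simp [h]
    have build : ∀ z₁ z₂ : ℝ, z₁ < z₂ → (∀ i, (σ i = σ 0 ∧ (t i < z₁ ∨ z₂ < t i)) ∨
        (σ i = -σ 0 ∧ z₁ < t i ∧ t i < z₂)) →
        ∃ z₁ z₂ : ℝ, z₁ < z₂ ∧ ∀ i, 0 < σ 0 * σ i * ((t i - z₁) * (t i - z₂)) := by
      refine fun z₁ z₂ hz hall => ⟨z₁, z₂, hz, fun i => ?_⟩
      rcases hall i with ⟨h1, h2 | h2⟩ | ⟨h1, h2, h3⟩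
      · rw [h1, h00]
        nlinarith
      · rw [h1, h00]
        nlinarith
      · rw [h1, mul_neg, h00]
        nlinarith
    have rel : ∀ i, σ i = σ 0 ∨ σ i = -σ 0 := by
      intro i
      rcases hσ i with h1 | h1 <;> rcases hσ 0 with h2 | h2 <;> simp [h1, h2]
    have hne : σ 0 ≠ -σ 0 := by
      rcases hσ 0 with h2 | h2 <;> norm_num [h2]
    rcases rel 1 with r1 | r1 <;> rcases rel 2 with r2 | r2 <;> rcases rel 3 with r3 | r3
    · exact build (t 3 + 1) (t 3 + 2) (by linarith) (by simp only [Fin.forall_fin_succ]; grind)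
    · exact build ((t 2 + t 3) / 2) (t 3 + 1) (by linarith) (by intro i; fin_cases i <;> grind)
    · exact build ((t 1 + t 2) / 2) ((t 2 + t 3) / 2) (by linarith)
        (by intro i; fin_cases i <;> grind)
    · exact build ((t 1 + t 2) / 2) (t 3 + 1) (by linarith) (by intro i; fin_cases i <;> grind)
    · exact build ((t 0 + t 1) / 2) ((t 1 + t 2) / 2) (by linarith)
        (by intro i; fin_cases i <;> grind)
    · exfalso
      rw [r1, r2, r3] at hadj
      grind
    · exact build ((t 0 + t 1) / 2) ((t 2 + t 3) / 2) (by linarith)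
        (by intro i; fin_cases i <;> grind)
    · exact build ((t 0 + t 1) / 2) (t 3 + 1) (by linarith) (by intro i; fin_cases i <;> grind)
  obtain ⟨z₁, z₂, hz, hq⟩ := quad
  refine ⟨σ 0, z₁, z₂, by rcases hσ 0 with h | h <;> simp [h], hz, fun i hi => ?_⟩
  have h1 := mul_pos (hq i) (hcσ i hi)
  have h2 : σ i * σ i = 1 := by rcases hσ i with h | h <;> simp [h]
  have h3 : σ 0 * σ i * ((t i - z₁) * (t i - z₂)) * (c i * σ i) =
    (σ i * σ i) * (σ 0 * c i * ((t i - z₁) * (t i - z₂))) := by ring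
  rwa [h3, h2, one_mul] at h1

/-- An exponential without four-point alternation can be strictly improved. -/
lemma exists_isExp_approxErr_lt {t T : Fin 4 → ℝ} (ht : StrictMono t) {a k b : ℝ}
    (ha : 0 < a) (hk : k < 0) {c : Fin 4 → ℝ} (hc : ∀ i, c i = T i - (a * exp (k * t i) + b))
    (h : ¬ (c 1 = -c 0 ∧ c 2 = c 0 ∧ c 3 = -c 0)) :
    ∃ g, IsExp g ∧ approxErr t T g < approxErr t T (fun s => a * exp (k * s) + b) := by
  set E := approxErr t T (fun s => a * exp (k * s) + b) with hEdef
  have hcE : ∀ i, |c i| ≤ E := by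
    intro i
    rw [hc, abs_sub_comm]
    exact abs_sub_le_approxErr t T (fun s => a * exp (k * s) + b) i
  have hE : 0 < E := by
    by_contra! hE
    have : ∀ i, c i = 0 := fun i => abs_nonpos_iff.1 ((hcE i).trans hE)
    exact h (by simp [this])
  obtain ⟨s, z₁, z₂, hs, hz, hsign⟩ := exists_quadratic_sign ht hE h
  set A : ℝ → ℝ := fun l => a * (exp (k * z₁) - exp (k * z₂)) / (exp (l * z₁) - exp (l * z₂))
    with hA
  set g : ℝ → ℝ → ℝ := fun l x => A l * exp (l * x) + (a * exp (k * z₁) + b - A l * exp (l * z₁))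
    with hg
  have hpos : ∀ l < 0, 0 < exp (l * z₁) - exp (l * z₂) := fun l hl =>
    sub_pos.2 (Real.exp_lt_exp.2 (by nlinarith))
  have hApos : ∀ l < 0, 0 < A l := fun l hl =>
    div_pos (mul_pos ha (hpos k hk)) (hpos l hl)
  have hAk : A k = a := by
    simp only [hA]
    field_simp [(hpos k hk).ne']
  have hcont : ∀ x, ContinuousAt (fun l => g l x) k := by
    intro x
    have := (hpos k hk).ne'
    simp only [hg, hA]
    fun_prop (disch := assumption)
  have hgk : ∀ x, g k x = a * exp (k * x) + b := by
    intro x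
    simp only [hg, hAk]
    ring
  have hdiff : ∀ l < 0, ∀ q x : ℝ, 0 < q * (k - l) * ((x - z₁) * (x - z₂)) →
      0 < q * (g l x - (a * exp (k * x) + b)) := by
    intro l hl q x hx
    have hA2 : A l * exp (l * z₁) - A l * exp (l * z₂) = a * exp (k * z₁) - a * exp (k * z₂) := by
      rw [← mul_sub, ← mul_sub]
      exact div_mul_cancel₀ _ (hpos l hl).ne'
    rcases lt_trichotomy l k with hlk | hlk | hlk
    · refine exp_sum_sign (A := A l) (B := -a) (C := a * exp (k * z₁) - A l * exp (l * z₁)) hk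
        ?_ hz (fun x => g l x - (a * exp (k * x) + b)) (fun x => by simp only [hg]; ring) ?_ ?_
        q ?_
      · exact mul_pos (hApos l hl) (mul_pos_of_neg_of_neg hl (by linarith))
      · simp only [hg]; ring
      · simp only [hg]; linarith
      · have : 0 < (k - l) * (q * ((x - z₁) * (x - z₂))) := by linarith
        exact pos_of_mul_pos_right this (by linarith)
    · simp [hlk] at hx
    · have := exp_sum_sign (A := -A l) (B := a) (C := -(a * exp (k * z₁) - A l * exp (l * z₁)))
        hk (x := x) ?_ hz (fun x => -(g l x - (a * exp (k * x) + b)))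
        (fun x => by simp only [hg]; ring) ?_ ?_ (-q) ?_
      · linarith
      · have := mul_pos (hApos l hl) (mul_pos_of_neg_of_neg hl (by linarith : k - l < 0))
        linarith
      · simp only [hg]; ring
      · simp only [hg]; linarith
      · have : 0 < (l - k) * (-q * ((x - z₁) * (x - z₂))) := by linarith
        exact pos_of_mul_pos_right this (by linarith)
  have hev : ∀ i, ∀ᶠ l in nhds k, l < 0 ∧ (0 < s * (k - l) → |g l (t i) - T i| < E) := by
    intro i
    have hneg : ∀ᶠ l in nhds k, l < 0 := gt_mem_nhds hk |>.mono fun _ h => h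
    rcases (hcE i).lt_or_eq with hi | hi
    · have h1 : ContinuousAt (fun l => |g l (t i) - T i|) k :=
        ((hcont (t i)).sub continuousAt_const).abs
      have h2 : |g k (t i) - T i| < E := by
        rw [hgk, abs_sub_comm, ← hc]
        exact hi
      filter_upwards [hneg, h1.eventually_lt continuousAt_const h2] with l h3 h4
      exact ⟨h3, fun _ => h4⟩
    · have h1 : ContinuousAt (fun l => |g l (t i) - (a * exp (k * t i) + b)|) k :=
        ((hcont (t i)).sub continuousAt_const).abs
      have h2 : |g k (t i) - (a * exp (k * t i) + b)| < E := by
        rw [hgk, sub_self, abs_zero]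
        exact hE
      filter_upwards [hneg, h1.eventually_lt continuousAt_const h2] with l h3 h4
      refine ⟨h3, fun hsl => ?_⟩
      have h5 := hsign i hi
      have h6 : 0 < c i * (k - l) * ((t i - z₁) * (t i - z₂)) := by
        have h7 : 0 < s ^ 2 * (c i * (k - l) * ((t i - z₁) * (t i - z₂))) := by
          have := mul_pos h5 hsl
          linarith
        exact pos_of_mul_pos_right h7 (sq_nonneg s)
      have h8 := hdiff l h3 _ _ h6
      have h9 := hc i
      rw [abs_lt] at h4 ⊢
      rcases (abs_eq hE.le).1 hi with h10 | h10
      · rw [h10] at h8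
        have := pos_of_mul_pos_right h8 hE.le
        constructor <;> linarith
      · rw [h10] at h8
        have : 0 < -(g l (t i) - (a * exp (k * t i) + b)) :=
          pos_of_mul_pos_right (a := E) (by linarith) hE.le
        constructor <;> linarith
  have hall : ∀ᶠ l in nhds k, ∀ i, l < 0 ∧ (0 < s * (k - l) → |g l (t i) - T i| < E) :=
    Filter.eventually_all.2 hev
  obtain ⟨l, hl, hsl⟩ : ∃ l, (∀ i, l < 0 ∧ (0 < s * (k - l) → |g l (t i) - T i| < E)) ∧
      0 < s * (k - l) := by
    have htend : Filter.Tendsto (fun ε : ℝ => k - ε * s) (nhdsWithin 0 (Set.Ioi 0)) (nhds k) := by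
      have : ContinuousAt (fun ε : ℝ => k - ε * s) 0 := by fun_prop
      have h1 := this.tendsto
      simp only [zero_mul, sub_zero] at h1
      exact h1.mono_left nhdsWithin_le_nhds
    obtain ⟨ε, hε, hε0⟩ := ((htend.eventually hall).and self_mem_nhdsWithin).exists
    refine ⟨_, hε, ?_⟩
    have h0 : 0 < ε := hε0
    have h1 : s * (k - (k - ε * s)) = ε * s ^ 2 := by ring
    rw [h1]
    positivity
  exact ⟨g l, ⟨A l, _, l, (hl 0).1.ne, rfl⟩, approxErr_lt fun i => (hl i).2 hsl⟩

/-- Slope condition equivalent to the existence of a decreasing convex exponential whose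
residuals alternate at the four points. -/
lemma exists_alternating_exp {t T : Fin 4 → ℝ} (ht : StrictMono t) (hP : T 3 < T 1)
    (hQ : (T 1 - T 3) * (t 2 - t 0) < (T 0 - T 2) * (t 3 - t 1)) :
    ∃ a k b r : ℝ, 0 < a ∧ k < 0 ∧
      T 0 - (a * exp (k * t 0) + b) = r ∧ T 1 - (a * exp (k * t 1) + b) = -r ∧
      T 2 - (a * exp (k * t 2) + b) = r ∧ T 3 - (a * exp (k * t 3) + b) = -r := by
  have t01 : t 0 < t 1 := ht (by decide)
  have t12 : t 1 < t 2 := ht (by decide)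
  have t23 : t 2 < t 3 := ht (by decide)
  set P := T 1 - T 3 with hPdef
  set Q := T 0 - T 2 with hQdef
  have hP0 : 0 < P := by linarith
  have hQ0 : 0 < Q := by
    have : 0 < P * (t 2 - t 0) := mul_pos hP0 (by linarith)
    exact pos_of_mul_pos_left (b := t 3 - t 1) (by linarith) (by linarith)
  set D : ℝ → ℝ := fun k => P * (exp (k * t 0) - exp (k * t 2)) -
    Q * (exp (k * t 1) - exp (k * t 3)) with hD
  have hcont : Continuous D := by
    simp only [hD]
    fun_prop
  obtain ⟨k₁, hk₁, hD₁⟩ : ∃ k < 0, D k < 0 := by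
    have he : ∀ x, HasDerivAt (fun k => exp (k * x)) x 0 := by
      intro x
      have := ((hasDerivAt_id (0 : ℝ)).mul_const x).exp
      simpa using this
    have hd : HasDerivAt D (P * (t 0 - t 2) - Q * (t 1 - t 3)) 0 :=
      (((he _).sub (he _)).const_mul P).sub (((he _).sub (he _)).const_mul Q)
    have hd0 : D 0 = 0 := by simp [hD]
    have hpos : 0 < P * (t 0 - t 2) - Q * (t 1 - t 3) := by linarith
    have h1 := (hasDerivAt_iff_tendsto_slope.1 hd).eventually (lt_mem_nhds hpos)
    have h2 : ∀ᶠ k in nhdsWithin (0 : ℝ) (Set.Iio 0), 0 < slope D 0 k :=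
      h1.filter_mono (nhdsWithin_mono _ fun x hx => ne_of_lt hx)
    obtain ⟨k, hk, hk0⟩ := (h2.and self_mem_nhdsWithin).exists
    have hk0' : k < 0 := hk0
    refine ⟨k, hk0', ?_⟩
    rw [slope_def_field, hd0, sub_zero, sub_zero] at hk
    exact (div_pos_iff.1 hk).elim (fun h => absurd h.2 hk0'.not_gt) fun h => h.1
  obtain ⟨k₂, hk₂, hD₂⟩ : ∃ k < 0, 0 < D k := by
    have hdt : 0 < t 1 - t 0 := sub_pos.2 t01
    refine ⟨-((Q / P + 1) / (t 1 - t 0)), by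
      have := div_pos hQ0 hP0
      rw [neg_lt_zero]
      positivity, ?_⟩
    set k := -((Q / P + 1) / (t 1 - t 0)) with hk
    have hk0 : k < 0 := by
      have := div_pos hQ0 hP0
      rw [hk, neg_lt_zero]
      positivity
    have hexp : exp (k * t 0) = exp (k * (t 0 - t 1)) * exp (k * t 1) := by
      rw [← Real.exp_add]
      ring_nf
    have hkt : k * (t 0 - t 1) = Q / P + 1 := by
      rw [hk]
      field_simp
      ring
    have h1 : Q / P + 2 ≤ exp (k * (t 0 - t 1)) := by
      have := Real.add_one_le_exp (k * (t 0 - t 1))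
      linarith
    have h2 : exp (k * t 2) < exp (k * t 1) := Real.exp_lt_exp.2 (by nlinarith)
    have h3 := Real.exp_pos (k * t 3)
    have h4 := Real.exp_pos (k * t 1)
    have h5 : P * ((Q / P + 2) * exp (k * t 1)) ≤ P * exp (k * t 0) := by
      rw [hexp]
      gcongr
    have h6 : P * ((Q / P + 2) * exp (k * t 1)) = (Q + 2 * P) * exp (k * t 1) := by
      field_simp
    have h7 : 0 < P * (exp (k * t 1) - exp (k * t 2)) := mul_pos hP0 (by linarith)
    have h8 : 0 < Q * exp (k * t 3) := mul_pos hQ0 h3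
    have h9 : 0 < P * exp (k * t 1) := mul_pos hP0 h4
    simp only [hD]
    linarith
  obtain ⟨k, hkmem, hk⟩ := isPreconnected_Iio.intermediate_value (Set.mem_Iio.2 hk₁)
    (Set.mem_Iio.2 hk₂) hcont.continuousOn ⟨hD₁.le, hD₂.le⟩
  have hk0 : k < 0 := hkmem
  have hden : 0 < exp (k * t 0) - exp (k * t 2) :=
    sub_pos.2 (Real.exp_lt_exp.2 (by nlinarith))
  set a := Q / (exp (k * t 0) - exp (k * t 2)) with ha
  have haQ : a * (exp (k * t 0) - exp (k * t 2)) = Q := div_mul_cancel₀ _ hden.ne'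
  have haP : a * (exp (k * t 1) - exp (k * t 3)) = P := by
    simp only [hD] at hk
    rw [ha, div_mul_eq_mul_div, div_eq_iff hden.ne']
    linarith
  refine ⟨a, k, (T 0 + T 1 - a * (exp (k * t 0) + exp (k * t 1))) / 2, _, div_pos hQ0 hden, hk0,
    rfl, ?_, ?_, ?_⟩ <;> linarith

/-- A convex decreasing exponential satisfies the slope condition at four points. -/
lemma exp_slope_lt {t : Fin 4 → ℝ} (ht : StrictMono t) {k : ℝ} (hk : k < 0) :
    exp (k * t 3) < exp (k * t 1) ∧ (exp (k * t 1) - exp (k * t 3)) * (t 2 - t 0) <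
      (exp (k * t 0) - exp (k * t 2)) * (t 3 - t 1) := by
  have t01 : t 0 < t 1 := ht (by decide)
  have t12 : t 1 < t 2 := ht (by decide)
  have t23 : t 2 < t 3 := ht (by decide)
  refine ⟨Real.exp_lt_exp.2 (by nlinarith), ?_⟩
  have h := fun x y z (hxy : x < y) (hyz : y < z) =>
    strictConvexOn_exp.slope_strict_mono_adjacent (Set.mem_univ (k * z)) (Set.mem_univ (k * x))
      (show k * z < k * y by nlinarith) (show k * y < k * x by nlinarith)
  have h1 := h _ _ _ t01 t12
  have h2 := h _ _ _ t12 t23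
  rw [← mul_sub, ← mul_sub, div_lt_div_iff₀ (by nlinarith) (by nlinarith)] at h1 h2
  have h1' : (exp (k * t 1) - exp (k * t 2)) * (t 1 - t 0) <
      (exp (k * t 0) - exp (k * t 1)) * (t 2 - t 1) := by nlinarith
  have h2' : (exp (k * t 2) - exp (k * t 3)) * (t 2 - t 1) <
      (exp (k * t 1) - exp (k * t 2)) * (t 3 - t 2) := by nlinarith
  have h3 := mul_lt_mul_of_pos_right (show (exp (k * t 1) - exp (k * t 3)) * (t 2 - t 1) <
    (exp (k * t 1) - exp (k * t 2)) * (t 3 - t 1) by linarith) (show 0 < t 2 - t 0 by linarith)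
  have h4 := mul_lt_mul_of_pos_right (show (exp (k * t 1) - exp (k * t 2)) * (t 2 - t 0) <
    (exp (k * t 0) - exp (k * t 2)) * (t 2 - t 1) by linarith) (show 0 < t 3 - t 1 by linarith)
  refine lt_of_mul_lt_mul_right (a := t 2 - t 1) ?_ (by linarith)
  linarith

lemma le_lineErr_of_alternating {n : ℕ} {t T : Fin n → ℝ} (ht : StrictMono t) {a b R : ℝ}
    {i j m : Fin n} (hij : i < j) (hjm : j < m) (hi : T i - (a * t i + b) = R)
    (hj : (a * t j + b) - T j = R) (hm : T m - (a * t m + b) = R) (c d : ℝ) :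
    R ≤ lineErr t T c d := by
  by_contra! h
  have ei := abs_lt.1 ((abs_sub_le_lineErr t T c d i).trans_lt h)
  have ej := abs_lt.1 ((abs_sub_le_lineErr t T c d j).trans_lt h)
  have em := abs_lt.1 ((abs_sub_le_lineErr t T c d m).trans_lt h)
  have h1 : 0 < (c - a) * (t i - t j) := by linarith
  have h2 : 0 < (c - a) * (t m - t j) := by linarith
  nlinarith [ht hij, ht hjm]

lemma admissible_of_alternating {n : ℕ} [NeZero n] {t T : Fin n → ℝ} (ht : StrictMono t)
    {a b R : ℝ} (ha : a < 0) (hle : ∀ l, |T l - (a * t l + b)| ≤ R)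
    {i j m : Fin n} (hij : i < j) (hjm : j < m) (hi : T i - (a * t i + b) = R)
    (hj : (a * t j + b) - T j = R) (hm : T m - (a * t m + b) = R)
    (hout : ∀ l, l < i ∨ m < l → -R < T l - (a * t l + b))
    (hin : ∀ l, i < l → l < m → T l - (a * t l + b) < R) : Admissible t T := by
  have hR : lineErr t T a b = R :=
    le_antisymm (ciSup_le hle) (le_lineErr_of_alternating ht hij hjm hi hj hm a b)
  refine ⟨a, b, fun c d => ?_, ha, i, j, m, hij, hjm, ?_⟩
  · rw [hR]
    exact le_lineErr_of_alternating ht hij hjm hi hj hm c d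
  · rw [hR]
    refine ⟨hi, hj, hm, fun l hl => ⟨?_, ?_⟩, fun l h1 h2 => ⟨?_, hin l h1 h2⟩⟩
    · linarith [(abs_le.1 (hle l)).2]
    · linarith [hout l hl]
    · exact (abs_le.1 (hle l)).1

lemma exists_alternating_line {x y z X Y Z : ℝ} (hxy : x < y) (hyz : y < z) :
    ∃ a b R : ℝ, X - (a * x + b) = R ∧ (a * y + b) - Y = R ∧ Z - (a * z + b) = R := by
  have h : z - x ≠ 0 := by linarith
  set a := (Z - X) / (z - x) with ha
  have haz : a * (z - x) = Z - X := div_mul_cancel₀ _ h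
  exact ⟨a, (X + Y - a * (x + y)) / 2, _, rfl, by ring, by linarith⟩

lemma forall_fin_four {p : Fin 4 → Prop} (h0 : p 0) (h1 : p 1) (h2 : p 2) (h3 : p 3) (l : Fin 4) :
    p l := by
  fin_cases l
  exacts [h0, h1, h2, h3]

/-- The alternating deviation of three points, in terms of their residuals from any line. -/
lemma alternating_deviation_eq {x y z X Y Z a b R : ℝ} (hX : X - (a * x + b) = R)
    (hY : (a * y + b) - Y = R) (hZ : Z - (a * z + b) = R) (c d : ℝ) :
    (X - (c * x + d)) * (z - y) - (Y - (c * y + d)) * (z - x) + (Z - (c * z + d)) * (y - x) =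
      2 * R * (z - x) := by
  obtain rfl : X = R + (a * x + b) := by linarith
  obtain rfl : Y = a * y + b - R := by linarith
  obtain rfl : Z = R + (a * z + b) := by linarith
  ring

lemma admissible_of_slope_lt {t T : Fin 4 → ℝ} (ht : StrictMono t) (hP : T 3 < T 1)
    (hQ : (T 1 - T 3) * (t 2 - t 0) < (T 0 - T 2) * (t 3 - t 1)) : Admissible t T := by
  have t01 : 0 < t 1 - t 0 := sub_pos.2 (ht (by decide))
  have t02 : 0 < t 2 - t 0 := sub_pos.2 (ht (by decide))
  have t03 : 0 < t 3 - t 0 := sub_pos.2 (ht (by decide))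
  have t12 : 0 < t 2 - t 1 := sub_pos.2 (ht (by decide))
  have t13 : 0 < t 3 - t 1 := sub_pos.2 (ht (by decide))
  have t23 : 0 < t 3 - t 2 := sub_pos.2 (ht (by decide))
  have hQ0 : 0 < T 0 - T 2 := by
    have : 0 < (T 1 - T 3) * (t 2 - t 0) := mul_pos (by linarith) t02
    exact pos_of_mul_pos_left (b := t 3 - t 1) (by linarith) t13.le
  have hres : ∀ c d : ℝ, ((T 1 - (c * t 1 + d)) - (T 3 - (c * t 3 + d))) * (t 2 - t 0) <
      ((T 0 - (c * t 0 + d)) - (T 2 - (c * t 2 + d))) * (t 3 - t 1) := by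
    intro c d
    linarith
  obtain ⟨a, b, A, a0, a1, a2⟩ := exists_alternating_line (X := T 0) (Y := T 1) (Z := T 2)
    (sub_pos.1 t01) (sub_pos.1 t12)
  obtain ⟨a', b', B, b0, b1, b3⟩ := exists_alternating_line (X := T 0) (Y := T 1) (Z := T 3)
    (sub_pos.1 t01) (sub_pos.1 t13)
  obtain ⟨a'', b'', C, c0, c2, c3⟩ := exists_alternating_line (X := T 0) (Y := T 2) (Z := T 3)
    (sub_pos.1 t02) (sub_pos.1 t23)
  obtain ⟨a₃, b₃, D, d1, d2, d3⟩ := exists_alternating_line (X := T 1) (Y := T 2) (Z := T 3)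
    (sub_pos.1 t12) (sub_pos.1 t23)
  have hA := alternating_deviation_eq a0 a1 a2
  have hB := alternating_deviation_eq b0 b1 b3
  have hC := alternating_deviation_eq c0 c2 c3
  have hD := alternating_deviation_eq d1 d2 d3
  have hmax : (B ≤ A ∧ C ≤ A ∧ D ≤ A) ∨ (A ≤ B ∧ C ≤ B ∧ D ≤ B) ∨
      (A ≤ C ∧ B ≤ C ∧ D ≤ C) ∨ (A ≤ D ∧ B ≤ D ∧ C ≤ D) := by
    clear * -
    grind
  rcases hmax with ⟨h1, -, -⟩ | ⟨h1, h2, -⟩ | ⟨-, h1, h2⟩ | ⟨-, -, h1⟩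
  · replace hB := hB a b
    replace hres := hres a b
    clear hA hC hD
    obtain ⟨x, hx⟩ : ∃ x, T 3 - (a * t 3 + b) = x := ⟨_, rfl⟩
    obtain hy : T 1 - (a * t 1 + b) = -A := by linarith
    rw [a0, hx, hy] at hB
    rw [a0, a2, hx, hy, sub_self, zero_mul] at hres
    have ha : a < 0 := by
      by_contra! h
      linarith [mul_nonneg h t02.le]
    have hxA : x ≤ A := by
      have : (x - A) * (t 1 - t 0) ≤ 0 := by
        linarith [mul_le_mul_of_nonneg_right h1 t03.le]
      linarith [nonpos_of_mul_nonpos_left this t01]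
    have hxA' : -A < x := by
      linarith [(neg_of_mul_neg_left hres t02.le : -A - x < 0)]
    refine admissible_of_alternating (i := 0) (j := 1) (m := 2) ht ha
        (forall_fin_four (abs_le.2 ⟨by linarith, by linarith⟩)
          (abs_le.2 ⟨by linarith, by linarith⟩)
          (abs_le.2 ⟨by linarith, by linarith⟩) (abs_le.2 ⟨by linarith, by linarith⟩))
        (by decide) (by decide) a0 a1 a2
        (forall_fin_four (fun h => absurd h (by decide)) (fun h => absurd h (by decide))
          (fun h => absurd h (by decide)) (fun _ => by linarith))
        (forall_fin_four (fun h => absurd h (by decide)) (fun _ _ => by linarith)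
          (fun _ h => absurd h (by decide)) (fun _ h => absurd h (by decide)))
  · replace hA := hA a' b'
    replace hC := hC a' b'
    replace hres := hres a' b'
    clear hB hD
    obtain ⟨x, hx⟩ : ∃ x, T 2 - (a' * t 2 + b') = x := ⟨_, rfl⟩
    obtain hy : T 1 - (a' * t 1 + b') = -B := by linarith
    rw [b0, hx, hy] at hA
    rw [b0, hx, b3] at hC
    rw [b0, b3, hx, hy] at hres
    have hxB : x ≤ B := by
      have : (x - B) * (t 1 - t 0) ≤ 0 := by
        linarith [mul_le_mul_of_nonneg_right h1 t02.le]
      linarith [nonpos_of_mul_nonpos_left this t01]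
    have hxB' : -B ≤ x := by
      have : (-B - x) * (t 3 - t 0) ≤ 0 := by
        linarith [mul_le_mul_of_nonneg_right h2 t03.le]
      linarith [nonpos_of_mul_nonpos_left this t03]
    have hpos : -B < B := by
      by_contra! h
      obtain rfl : B = 0 := by linarith
      obtain rfl : x = 0 := by linarith
      simp at hres
    have ha : a' < 0 := by
      by_contra! h
      linarith [mul_nonneg h t13.le]
    rcases hxB.lt_or_eq with hlt | rfl
    · refine admissible_of_alternating (i := 0) (j := 1) (m := 3) ht ha
          (forall_fin_four (abs_le.2 ⟨by linarith, by linarith⟩)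
            (abs_le.2 ⟨by linarith, by linarith⟩)
            (abs_le.2 ⟨by linarith, by linarith⟩) (abs_le.2 ⟨by linarith, by linarith⟩))
          (by decide) (by decide) b0 b1 b3
          (forall_fin_four (fun h => absurd h (by decide)) (fun h => absurd h (by decide))
            (fun h => absurd h (by decide)) (fun h => absurd h (by decide)))
          (forall_fin_four (fun h => absurd h (by decide)) (fun _ _ => by linarith)
            (fun _ _ => by linarith) (fun _ h => absurd h (by decide)))
    · refine admissible_of_alternating (i := 0) (j := 1) (m := 2) ht ha
          (forall_fin_four (abs_le.2 ⟨by linarith, by linarith⟩)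
            (abs_le.2 ⟨by linarith, by linarith⟩)
            (abs_le.2 ⟨by linarith, by linarith⟩) (abs_le.2 ⟨by linarith, by linarith⟩))
          (by decide) (by decide) b0 b1 hx
          (forall_fin_four (fun h => absurd h (by decide)) (fun h => absurd h (by decide))
            (fun h => absurd h (by decide)) (fun _ => by linarith))
          (forall_fin_four (fun h => absurd h (by decide)) (fun _ _ => by linarith)
            (fun _ h => absurd h (by decide)) (fun _ h => absurd h (by decide)))
  · replace hB := hB a'' b''
    replace hD := hD a'' b''
    replace hres := hres a'' b''
    clear hA hC
    obtain ⟨x, hx⟩ : ∃ x, T 1 - (a'' * t 1 + b'') = x := ⟨_, rfl⟩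
    obtain hy : T 2 - (a'' * t 2 + b'') = -C := by linarith
    rw [c0, hx, c3] at hB
    rw [hx, hy, c3] at hD
    rw [c0, c3, hx, hy] at hres
    have hxC : x ≤ C := by
      have : (x - C) * (t 3 - t 2) ≤ 0 := by
        linarith [mul_le_mul_of_nonneg_right h2 t13.le]
      linarith [nonpos_of_mul_nonpos_left this t23]
    have hxC' : -C ≤ x := by
      have : (-C - x) * (t 3 - t 0) ≤ 0 := by
        linarith [mul_le_mul_of_nonneg_right h1 t03.le]
      linarith [nonpos_of_mul_nonpos_left this t03]
    have hpos : -C < C := by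
      by_contra! h
      obtain rfl : C = 0 := by linarith
      obtain rfl : x = 0 := by linarith
      simp at hres
    have ha : a'' < 0 := by
      by_contra! h
      linarith [mul_nonneg h t13.le]
    rcases hxC.lt_or_eq with hlt | rfl
    · refine admissible_of_alternating (i := 0) (j := 2) (m := 3) ht ha
          (forall_fin_four (abs_le.2 ⟨by linarith, by linarith⟩)
            (abs_le.2 ⟨by linarith, by linarith⟩)
            (abs_le.2 ⟨by linarith, by linarith⟩) (abs_le.2 ⟨by linarith, by linarith⟩))
          (by decide) (by decide) c0 c2 c3
          (forall_fin_four (fun h => absurd h (by decide)) (fun h => absurd h (by decide))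
            (fun h => absurd h (by decide)) (fun h => absurd h (by decide)))
          (forall_fin_four (fun h => absurd h (by decide)) (fun _ _ => by linarith)
            (fun _ _ => by linarith) (fun _ h => absurd h (by decide)))
    · refine admissible_of_alternating (i := 1) (j := 2) (m := 3) ht ha
          (forall_fin_four (abs_le.2 ⟨by linarith, by linarith⟩)
            (abs_le.2 ⟨by linarith, by linarith⟩)
            (abs_le.2 ⟨by linarith, by linarith⟩) (abs_le.2 ⟨by linarith, by linarith⟩))
          (by decide) (by decide) hx c2 c3
          (forall_fin_four (fun _ => by linarith) (fun h => absurd h (by decide))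
            (fun h => absurd h (by decide)) (fun h => absurd h (by decide)))
          (forall_fin_four (fun h => absurd h (by decide)) (fun h => absurd h (by decide))
            (fun _ _ => by linarith) (fun _ h => absurd h (by decide)))
  · replace hC := hC a₃ b₃
    replace hres := hres a₃ b₃
    clear hA hB hD
    obtain ⟨x, hx⟩ : ∃ x, T 0 - (a₃ * t 0 + b₃) = x := ⟨_, rfl⟩
    obtain hy : T 2 - (a₃ * t 2 + b₃) = -D := by linarith
    rw [hx, hy, d3] at hC
    rw [d1, d3, hx, hy, sub_self, zero_mul] at hres
    have ha : a₃ < 0 := by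
      by_contra! h
      linarith [mul_nonneg h t13.le]
    have hxD : x ≤ D := by
      have : (x - D) * (t 3 - t 2) ≤ 0 := by
        linarith [mul_le_mul_of_nonneg_right h1 t03.le]
      linarith [nonpos_of_mul_nonpos_left this t23]
    have hxD' : -D < x := by
      linarith [(pos_of_mul_pos_left hres t13.le : 0 < x - -D)]
    refine admissible_of_alternating (i := 1) (j := 2) (m := 3) ht ha
        (forall_fin_four (abs_le.2 ⟨by linarith, by linarith⟩)
          (abs_le.2 ⟨by linarith, by linarith⟩)
          (abs_le.2 ⟨by linarith, by linarith⟩) (abs_le.2 ⟨by linarith, by linarith⟩))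
        (by decide) (by decide) d1 d2 d3
        (forall_fin_four (fun _ => by linarith) (fun h => absurd h (by decide))
          (fun h => absurd h (by decide)) (fun h => absurd h (by decide)))
        (forall_fin_four (fun h => absurd h (by decide)) (fun h => absurd h (by decide))
          (fun _ _ => by linarith) (fun _ h => absurd h (by decide)))

lemma spade_of_le {T : Fin 4 → ℝ} (h0 : ∀ l, T l ≤ T 0) (h13 : T 1 ≤ T 3) :
    Spade (by norm_num) T := by
  refine ⟨h0, ?_⟩
  rcases le_total (T 2) (T 3) with h | h
  · rcases le_total (T 1) (T 2) with h' | h'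
    · exact ⟨1, 3, by decide, by decide, forall_fin_four (h0 1) le_rfl h' h13,
        forall_fin_four (fun h => absurd h (by decide)) (fun _ => h13) (fun _ => h)
          (fun _ => le_rfl)⟩
    · exact ⟨2, 3, by decide, by decide, forall_fin_four (h0 2) h' le_rfl h,
        forall_fin_four (fun h => absurd h (by decide)) (fun _ => h13) (fun _ => h)
          (fun _ => le_rfl)⟩
  · exact ⟨1, 2, by decide, by decide, forall_fin_four (h0 1) le_rfl (h13.trans h) h13,
      forall_fin_four (fun h => absurd h (by decide)) (fun _ => h13.trans h) (fun _ => le_rfl)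
        (fun _ => h)⟩

lemma slope_lt_of_admissible {t T : Fin 4 → ℝ} (ht : StrictMono t) (h : Admissible t T)
    (hs : ¬ Spade (by norm_num) T) :
    T 3 < T 1 ∧ (T 1 - T 3) * (t 2 - t 0) < (T 0 - T 2) * (t 3 - t 1) := by
  have t02 : 0 < t 2 - t 0 := sub_pos.2 (ht (by decide))
  have t13 : 0 < t 3 - t 1 := sub_pos.2 (ht (by decide))
  obtain ⟨a, b, -, ha, i, j, m, hij, hjm, hi, hj, hm, hout, hin⟩ := h
  have hE := fun l => abs_le.1 (abs_sub_le_lineErr t T a b l)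
  set R := lineErr t T a b with hR
  have hpos : 0 < R := by linarith [hin j hij hjm]
  have hspade : T 0 - (a * t 0 + b) = R → T 3 < T 1 := by
    intro h0
    by_contra! h13
    refine hs (spade_of_le (fun l => ?_) h13)
    have : 0 ≤ -a * (t l - t 0) :=
      mul_nonneg (by linarith) (sub_nonneg.2 (ht.monotone (Fin.zero_le l)))
    linarith [(hE l).2]
  obtain ⟨e, he⟩ : ∃ e : Fin 4 → ℝ, ∀ l, T l = e l + (a * t l + b) :=
    ⟨fun l => T l - (a * t l + b), fun l => by ring⟩
  have heq : ∀ l, T l - (a * t l + b) = e l := fun l => by rw [he]; ring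
  have heq' : ∀ l, a * t l + b - T l = -e l := fun l => by rw [he]; ring
  simp only [heq, heq'] at hi hj hm hout hin hE hspade
  have hQ : ∀ (_ : e 1 - e 3 ≤ 0) (_ : 0 ≤ e 0 - e 2) (_ : e 1 < e 3 ∨ e 2 < e 0),
      (T 1 - T 3) * (t 2 - t 0) < (T 0 - T 2) * (t 3 - t 1) := by
    intro h1 h2 h3
    have h4 : (e 1 - e 3) * (t 2 - t 0) < (e 0 - e 2) * (t 3 - t 1) := by
      rcases h3 with h3 | h3
      · exact (mul_neg_of_neg_of_pos (by linarith) t02).trans_le (mul_nonneg h2 t13.le)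
      · exact (mul_nonpos_of_nonpos_of_nonneg h1 t02.le).trans_lt (mul_pos (by linarith) t13)
    rw [he 0, he 1, he 2, he 3]
    linarith
  have htriple : (i = 0 ∧ j = 1 ∧ m = 2) ∨ (i = 0 ∧ j = 1 ∧ m = 3) ∨
      (i = 0 ∧ j = 2 ∧ m = 3) ∨ (i = 1 ∧ j = 2 ∧ m = 3) := by
    omega
  rcases htriple with ⟨rfl, rfl, rfl⟩ | ⟨rfl, rfl, rfl⟩ | ⟨rfl, rfl, rfl⟩ | ⟨rfl, rfl, rfl⟩
  · have := hout 3 (by decide)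
    exact ⟨hspade hi, hQ (by linarith) (by linarith) (Or.inl (by linarith))⟩
  · have := hE 2
    exact ⟨hspade hi, hQ (by linarith) (by linarith) (Or.inl (by linarith))⟩
  · have := hE 1
    exact ⟨hspade hi, hQ (by linarith) (by linarith) (Or.inr (by linarith))⟩
  · have := hout 0 (by decide)
    refine ⟨?_, hQ (by linarith) (by linarith) (Or.inr (by linarith))⟩
    have := mul_neg_of_neg_of_pos ha t13
    linarith [he 1, he 3]

lemma not_spade_of_lt {T : Fin 4 → ℝ} (hP : T 3 < T 1) : ¬ Spade (by norm_num) T := by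
  rintro ⟨-, i, j, hi, hij, hmin, hmax⟩
  have h1 := hmin 3
  have h2 := hmax 1 (by decide)
  fin_cases i <;> fin_cases j <;> simp at * <;> linarith

/-- For a dataset with `n = 4`, there is an exponential `f(t)=a·exp(k·t)+b`
with `a > 0`, `k < 0` which is the strictly unique best exponential approximation if and
only if the dataset is admissible and ♠ does not hold. -/
theorem stmt_13 (t T : Fin 4 → ℝ) (ht : StrictMono t) :
    (∃ a k b : ℝ, 0 < a ∧ k < 0 ∧
      ∀ g : ℝ → ℝ, IsExp g → g ≠ (fun s => a * Real.exp (k * s) + b) →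
        approxErr t T (fun s => a * Real.exp (k * s) + b) < approxErr t T g) ↔
    (Admissible t T ∧ ¬ Spade (by norm_num) T) := by
  constructor
  · rintro ⟨a, k, b, ha, hk, hbest⟩
    obtain ⟨h1, h2⟩ : T 3 < T 1 ∧ (T 1 - T 3) * (t 2 - t 0) < (T 0 - T 2) * (t 3 - t 1) := by
      obtain ⟨h1, h2, h3⟩ : T 1 - (a * exp (k * t 1) + b) = -(T 0 - (a * exp (k * t 0) + b)) ∧
          T 2 - (a * exp (k * t 2) + b) = T 0 - (a * exp (k * t 0) + b) ∧
          T 3 - (a * exp (k * t 3) + b) = -(T 0 - (a * exp (k * t 0) + b)) := by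
        by_contra hna
        obtain ⟨g, hg, hlt⟩ := exists_isExp_approxErr_lt ht ha hk
          (c := fun i => T i - (a * exp (k * t i) + b)) (fun _ => rfl) hna
        exact lt_asymm hlt (hbest g hg fun heq => hlt.ne (by rw [heq]))
      obtain ⟨h4, h5⟩ := exp_slope_lt ht hk
      have h13 : T 1 - T 3 = a * (exp (k * t 1) - exp (k * t 3)) := by linarith
      have h02 : T 0 - T 2 = a * (exp (k * t 0) - exp (k * t 2)) := by linarith
      refine ⟨sub_pos.1 ?_, ?_⟩
      · rw [h13]
        exact mul_pos ha (sub_pos.2 h4)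
      · rw [h13, h02, mul_assoc, mul_assoc]
        exact mul_lt_mul_of_pos_left h5 ha
    exact ⟨admissible_of_slope_lt ht h1 h2, not_spade_of_lt h1⟩
  · rintro ⟨hadm, hs⟩
    obtain ⟨h1, h2⟩ := slope_lt_of_admissible ht hadm hs
    obtain ⟨a, k, b, r, ha, hk, e0, e1, e2, e3⟩ := exists_alternating_exp ht h1 h2
    exact ⟨a, k, b, ha, hk, fun g hg hne =>
      approxErr_lt_of_alternating ht hk e0 e1 e2 e3 hg hne⟩
end
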